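/- arXiv:1908.06511 — 3 statements merged into one kernel-verified Lean document; each statement's English description precedes it below -/
import Mathlib

section
/- For every prime p ∈ {7, 11, 19, 31}, the group PSL(2,p) satisfies the replacement property. -/
section Defs

variable {G : Type*} [Group G]

/-- `g` is a generating sequence of `G`: the set of its entries generates `G`. -/
def IsGenSeq {n : ℕ} (g : Fin n → G) : Prop :=
  Subgroup.closure (Set.range g) = ⊤

/-- `g` is irredundant: for each `i`, the entries other than `g i` do not generate `G`. -/
def IsIrred {n : ℕ} (g : Fin n → G) : Prop :=
  ∀ i : Fin n, Subgroup.closure (g '' {j | j ≠ i}) ≠ ⊤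

/-- `m(G)`: the largest length of an irredundant generating sequence of `G`. -/
noncomputable def maxIrredLen (G : Type*) [Group G] : ℕ :=
  sSup {n | ∃ g : Fin n → G, IsGenSeq g ∧ IsIrred g}

/-- `G` satisfies the replacement property. -/
def ReplacementProperty (G : Type*) [Group G] : Prop :=
  ∀ g : Fin (maxIrredLen G) → G, IsGenSeq g → IsIrred g →
    ∀ x : G, x ≠ 1 → ∃ i, IsGenSeq (Function.update g i x)

/-- `x` is a witness to failure of the replacement property for `G`. -/
def IsWitnessToFailure {G : Type*} [Group G] (x : G) : Prop :=
  x ≠ 1 ∧ ∃ g : Fin (maxIrredLen G) → G, IsGenSeq g ∧ IsIrred g ∧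
    ∀ i, ¬ IsGenSeq (Function.update g i x)

/-- A family of subgroups is in general position. -/
def InGeneralPosition {n : ℕ} (H : Fin n → Subgroup G) : Prop :=
  ∀ j, ¬ ((⨅ i ∈ ({j}ᶜ : Set (Fin n)), H i) ≤ H j)

/-- The sequence of subgroups `M` corresponds to the sequence of elements `g`. -/
def Corresponds {n : ℕ} (M : Fin n → Subgroup G) (g : Fin n → G) : Prop :=
  (∀ i j, j ≠ i → g i ∈ M j) ∧ ∀ i, g i ∉ M i

end Defs

/-- `PSL(2,p)`. -/
abbrev PSL (p : ℕ) : Type := Matrix.ProjectiveSpecialLinearGroup (Fin 2) (ZMod p)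

section FixedPoints

open MulAction

theorem orders_of_sum_eq_sorted {n s₁ s₂ s₃ r₁ r₂ r₃ : ℕ} (h₁ : n = s₁ * r₁) (h₂ : n = s₂ * r₂)
    (h₃ : n = s₃ * r₃) (hs : s₁ + s₂ + s₃ = n + 2) (l₃ : 3 ≤ s₃)
    (hr : 2 ≤ r₁) (h₁₂ : s₂ ≤ s₁) (h₂₃ : s₃ ≤ s₂) :
    ∃ r, ((n = 12 ∧ r = 3) ∨ (n = 24 ∧ r = 4) ∨ (n = 60 ∧ r = 5)) ∧
      n ≤ s₁ * r ∧ n ≤ s₂ * r ∧ n ≤ s₃ * r := by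
  have e₁ : r₁ = 2 := by
    by_contra h
    have : 3 ≤ r₁ := by omega
    nlinarith
  subst e₁
  have e₂ : r₂ = 3 := by
    by_contra h
    have : r₂ ≤ 2 ∨ 4 ≤ r₂ := by omega
    rcases this with h | h
    · have : s₂ * r₂ ≤ s₂ * 2 := Nat.mul_le_mul_left _ h
      omega
    · nlinarith
  subst e₂
  have : r₃ < 6 := by
    by_contra h
    have : s₃ * 6 ≤ s₃ * r₃ := Nat.mul_le_mul_left _ (by omega)
    omega
  refine ⟨r₃, ?_⟩
  interval_cases r₃ <;> omega

theorem orders_of_sum_eq {n s₁ s₂ s₃ : ℕ} (h₁ : s₁ ∣ n) (h₂ : s₂ ∣ n)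
    (h₃ : s₃ ∣ n) (hs : s₁ + s₂ + s₃ = n + 2) (l₁ : 3 ≤ s₁) (l₂ : 3 ≤ s₂) (l₃ : 3 ≤ s₃)
    (t₁ : s₁ ≠ n) (t₂ : s₂ ≠ n) (t₃ : s₃ ≠ n) :
    ∃ r, ((n = 12 ∧ r = 3) ∨ (n = 24 ∧ r = 4) ∨ (n = 60 ∧ r = 5)) ∧
      n ≤ s₁ * r ∧ n ≤ s₂ * r ∧ n ≤ s₃ * r := by
  obtain ⟨r₁, h₁⟩ := h₁
  obtain ⟨r₂, h₂⟩ := h₂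
  obtain ⟨r₃, h₃⟩ := h₃
  have hr : ∀ {s r : ℕ}, n = s * r → s ≠ n → 3 ≤ s → 2 ≤ r := by
    intro s r h hn hs
    rcases r with _ | _ | r
    · omega
    · omega
    · omega
  have g₁ := hr h₁ t₁ l₁
  have g₂ := hr h₂ t₂ l₂
  have g₃ := hr h₃ t₃ l₃
  rcases le_total s₁ s₂ with a | a <;> rcases le_total s₂ s₃ with b | b
  · obtain ⟨r, h⟩ := orders_of_sum_eq_sorted h₃ h₂ h₁ (by omega) l₁ g₃ b a
    exact ⟨r, by tauto⟩
  · rcases le_total s₁ s₃ with c | c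
    · obtain ⟨r, h⟩ := orders_of_sum_eq_sorted h₂ h₃ h₁ (by omega) l₁ g₂ b c
      exact ⟨r, by tauto⟩
    · obtain ⟨r, h⟩ := orders_of_sum_eq_sorted h₂ h₁ h₃ (by omega) l₃ g₂ a c
      exact ⟨r, by tauto⟩
  · rcases le_total s₁ s₃ with c | c
    · obtain ⟨r, h⟩ := orders_of_sum_eq_sorted h₃ h₁ h₂ (by omega) l₂ g₃ c a
      exact ⟨r, by tauto⟩
    · obtain ⟨r, h⟩ := orders_of_sum_eq_sorted h₁ h₃ h₂ (by omega) l₂ g₁ c b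
      exact ⟨r, by tauto⟩
  · exact orders_of_sum_eq_sorted h₁ h₂ h₃ hs l₃ g₁ a b

theorem sum_card_sub_card_orbit {H P : Type*} [Group H] [MulAction H P] [Finite H] [Finite P]
    [Fintype (orbitRel.Quotient H P)]
    (hfix : ∀ h : H, h ≠ 1 → Nat.card (fixedBy P h) = 2) :
    ∑ ω : orbitRel.Quotient H P, ((Nat.card H : ℤ) - Nat.card ω.orbit) = 2 * Nat.card H - 2 := by
  classical
  have := Fintype.ofFinite H
  have := Fintype.ofFinite P
  have burnside := sum_card_fixedBy_eq_card_orbits_mul_card_group H P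
  have h₁ : ∑ h : H, Fintype.card (fixedBy P h) =
      Nat.card P + (Fintype.card H - 1) * 2 := by
    rw [← Finset.add_sum_erase _ _ (Finset.mem_univ (1 : H)), Finset.sum_congr rfl
      (g := fun _ => 2)]
    · simp [Finset.card_erase_of_mem]
    · intro h hh
      rw [← hfix h (Finset.ne_of_mem_erase hh), Nat.card_eq_fintype_card]
  have h₂ : ∑ ω : orbitRel.Quotient H P, Nat.card ω.orbit = Nat.card P := by
    rw [Nat.card_congr (selfEquivSigmaOrbits' H P), Nat.card_sigma]
  have h₃ : 0 < Fintype.card H := Fintype.card_pos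
  have h₄ : (∑ ω : orbitRel.Quotient H P, (Nat.card ω.orbit : ℤ)) = Nat.card P := by
    exact_mod_cast h₂
  rw [Finset.sum_sub_distrib, h₄]
  simp only [Finset.sum_const, Finset.card_univ, nsmul_eq_mul]
  rw [h₁] at burnside
  rw [Nat.card_eq_fintype_card (α := H)]
  zify [h₃] at burnside
  have h₅ : (Fintype.card (Quotient (orbitRel H P)) : ℤ) =
    Fintype.card (orbitRel.Quotient H P) := by norm_cast
  rw [h₅] at burnside
  linarith

theorem card_of_two_fixed_points {H P : Type*} [Group H] [MulAction H P] [Finite H] [Finite P]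
    [Nonempty P] (hfix : ∀ h : H, h ≠ 1 → Nat.card (fixedBy P h) = 2) :
    (∃ z : P, Nat.card (orbit H z) ≤ 2) ∨ ∃ r, ((Nat.card H = 12 ∧ r = 3) ∨
      (Nat.card H = 24 ∧ r = 4) ∨ (Nat.card H = 60 ∧ r = 5)) ∧
      ∀ z : P, Nat.card (stabilizer H z) ≤ r := by
  classical
  by_cases hz : ∃ z : P, Nat.card (orbit H z) ≤ 2
  · exact .inl hz
  push Not at hz
  right
  have := Fintype.ofFinite (orbitRel.Quotient H P)
  have hmul : ∀ z : P, Nat.card (orbit H z) * Nat.card (stabilizer H z) = Nat.card H := fun z => by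
    have := Fintype.ofFinite H
    have := Fintype.ofFinite (orbit H z)
    have := Fintype.ofFinite (stabilizer H z)
    simpa only [Nat.card_eq_fintype_card] using card_orbit_mul_card_stabilizer_eq_card_group H z
  set n := Nat.card H with hn
  have hn0 : 0 < n := Nat.card_pos
  set s : orbitRel.Quotient H P → ℕ := fun ω => Nat.card ω.orbit with hs
  have hs_mk : ∀ z : P, s (Quotient.mk _ z) = Nat.card (orbit H z) := fun z => by
    simp only [hs]; rfl
  have hdvd : ∀ ω, s ω ∣ n := fun ω => by
    induction ω using Quotient.inductionOn' with | h z => exact ⟨_, (hmul z).symm⟩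
  have h3 : ∀ ω, 3 ≤ s ω := fun ω => by
    induction ω using Quotient.inductionOn' with | h z => exact hz z
  have hsum := sum_card_sub_card_orbit hfix
  set S := Finset.univ.filter fun ω => s ω ≠ n with hS
  have hsumS : ∑ ω ∈ S, ((n : ℤ) - s ω) = 2 * n - 2 := by
    rw [← hsum, hS, Finset.sum_filter]
    refine Finset.sum_congr rfl fun ω _ => ?_
    split_ifs with h
    · rfl
    · rw [not_not] at h
      exact (sub_eq_zero.mpr (by exact_mod_cast h.symm)).symm
  have hhalf : ∀ ω ∈ S, 2 * s ω ≤ n := fun ω hω => by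
    obtain ⟨r, hr⟩ := hdvd ω
    have hne : s ω ≠ n := (Finset.mem_filter.mp hω).2
    have h2 : 2 ≤ r := by
      rcases r with _ | _ | r
      · omega
      · omega
      · omega
    nlinarith
  have hle : S.card ≤ 3 := by
    by_contra hc
    have h1 : S.card • (n : ℤ) ≤ ∑ ω ∈ S, 2 * ((n : ℤ) - s ω) :=
      Finset.card_nsmul_le_sum _ _ _ fun ω hω => by have := hhalf ω hω; omega
    rw [← Finset.mul_sum, hsumS, nsmul_eq_mul] at h1
    have h4 : (4 : ℤ) ≤ S.card := by omega
    nlinarith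
  have hge : 3 ≤ S.card := by
    by_contra hc
    have h1 : ∑ ω ∈ S, ((n : ℤ) - s ω) ≤ S.card • ((n : ℤ) - 3) :=
      Finset.sum_le_card_nsmul _ _ _ fun ω _ => by have := h3 ω; omega
    rw [hsumS, nsmul_eq_mul] at h1
    have hn3 : (3 : ℤ) ≤ n := by
      obtain ⟨z⟩ := ‹Nonempty P›
      have := Nat.le_of_dvd hn0 ⟨_, (hmul z).symm⟩
      have := hz z
      omega
    have h4 : (S.card : ℤ) ≤ 2 := by omega
    nlinarith
  obtain ⟨x, y, w, hxy, hxw, hyw, hSeq⟩ := Finset.card_eq_three.mp (le_antisymm hle hge)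
  have hne : ∀ ω ∈ S, s ω ≠ n := fun ω hω => (Finset.mem_filter.mp hω).2
  rw [hSeq, Finset.sum_insert (by simp [hxy, hxw]), Finset.sum_pair hyw] at hsumS
  obtain ⟨r, hr, hx, hy, hw⟩ := orders_of_sum_eq (hdvd x) (hdvd y) (hdvd w) (by omega) (h3 x) (h3 y)
    (h3 w) (hne x (by simp [hSeq])) (hne y (by simp [hSeq])) (hne w (by simp [hSeq]))
  refine ⟨r, hr, fun z => ?_⟩
  have key : n ≤ s (Quotient.mk _ z) * r := by
    by_cases hzS : (Quotient.mk _ z : orbitRel.Quotient H P) ∈ S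
    · rw [hSeq, Finset.mem_insert, Finset.mem_insert, Finset.mem_singleton] at hzS
      rcases hzS with h | h | h <;> rw [h] <;> assumption
    · have h : s (Quotient.mk _ z) = n := by
        by_contra h
        exact hzS (Finset.mem_filter.mpr ⟨Finset.mem_univ _, h⟩)
      rw [h]
      exact Nat.le_mul_of_pos_right _ (by omega)
  rw [hs_mk, ← hmul z] at key
  exact Nat.le_of_mul_le_mul_left key (by have := hz z; omega)

theorem card_orbit_mul_card_stabilizer' {H P : Type*} [Group H] [MulAction H P] [Finite H] (z : P) :
    Nat.card (orbit H z) * Nat.card (stabilizer H z) = Nat.card H := by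
  rw [← Nat.card_prod, Nat.card_congr (orbitProdStabilizerEquivGroup H z)]

namespace Subgroup

variable {G P : Type*} [Group G] [MulAction G P]

theorem card_subgroupOf (H K : Subgroup G) :
    Nat.card (H.subgroupOf K) = Nat.card (H ⊓ K : Subgroup G) := by
  rw [← subgroupOf_map_subtype, card_map_of_injective K.subtype_injective]

theorem card_stabilizer_subgroup (M : Subgroup G) (z : P) :
    Nat.card (stabilizer M z) = Nat.card (M ⊓ stabilizer G z : Subgroup G) := by
  rw [inf_comm, ← card_subgroupOf]
  rfl

theorem card_le_of_card_orbit_le_two [Finite G] {M : Subgroup G} {z : P}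
    (h : Nat.card (orbit M z) ≤ 2) :
    Nat.card M ≤ 2 * Nat.card (M ⊓ stabilizer G z : Subgroup G) := by
  rw [← card_orbit_mul_card_stabilizer' (H := M) z, card_stabilizer_subgroup]
  exact Nat.mul_le_mul_right _ h

theorem card_of_two_fixed_points [Finite G] [Finite P] [Nonempty P] {M : Subgroup G}
    (hfix : ∀ g ∈ M, g ≠ 1 → Nat.card (fixedBy P g) = 2) :
    (∃ z : P, Nat.card M ≤ 2 * Nat.card (M ⊓ stabilizer G z : Subgroup G)) ∨
      ∃ r, ((Nat.card M = 12 ∧ r = 3) ∨ (Nat.card M = 24 ∧ r = 4) ∨ (Nat.card M = 60 ∧ r = 5)) ∧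
      ∀ z : P, Nat.card (M ⊓ stabilizer G z : Subgroup G) ≤ r := by
  rcases _root_.card_of_two_fixed_points (H := M) (P := P)
    (fun h hh => hfix h h.2 (by simpa using hh)) with ⟨z, hz⟩ | ⟨r, hr, h⟩
  · exact .inl ⟨z, card_le_of_card_orbit_le_two hz⟩
  · exact .inr ⟨r, hr, fun z => by rw [← card_stabilizer_subgroup]; exact h z⟩

theorem card_le_of_normalizes [Finite G] [Finite P] {A D : Subgroup G}
    (hD : (Nat.card D).Prime) (hA : A ≤ normalizer (D : Set G))
    (hfix : ∀ g ∈ D, g ≠ 1 → Nat.card (fixedBy P g) = 2) :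
    ∃ z : P, Nat.card A ≤ 2 * Nat.card (A ⊓ stabilizer G z : Subgroup G) := by
  have := Fact.mk hD
  obtain ⟨x, hx⟩ : ∃ x : D, x ≠ 1 := by
    have := Finite.one_lt_card_iff_nontrivial.mp hD.one_lt
    exact exists_ne 1
  have hx2 := hfix x x.2 (by simpa using hx)
  obtain ⟨⟨z, hz⟩⟩ : Nonempty (fixedBy P (x : G)) :=
    (Nat.card_pos_iff.mp (by omega)).1
  have hDz : D ≤ stabilizer G z := by
    intro y hy
    have : (⟨y, hy⟩ : D) ∈ zpowers x := by
      rw [zpowers_eq_top_of_prime_card (p := Nat.card D) rfl hx]; trivial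
    obtain ⟨k, hk⟩ := this
    have hk' : (x : G) ^ k = y := by simpa using congrArg Subtype.val hk
    rw [← hk']
    exact zpow_mem (mem_stabilizer_iff.mpr hz) k
  refine ⟨z, card_le_of_card_orbit_le_two ?_⟩
  rw [← hx2]
  refine Nat.card_mono (Set.toFinite _) ?_
  rintro _ ⟨a, rfl⟩
  have ha := mem_normalizer_iff.mp (inv_mem (hA a.2)) x
  have := mem_stabilizer_iff.mp (hDz (ha.mp x.2))
  simp only [inv_inv, mul_smul] at this
  rw [mem_fixedBy]
  exact (inv_smul_eq_iff.mp this)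

theorem index_subgroupOf_eq_two [Finite G] {H K : Subgroup G} (hHK : H ≤ K)
    (h : Nat.card K = 2 * Nat.card H) : (H.subgroupOf K).index = 2 := by
  have h₁ := card_mul_index (H.subgroupOf K)
  rw [card_subgroupOf, inf_eq_left.mpr hHK, h, mul_comm] at h₁
  exact Nat.eq_of_mul_eq_mul_right Nat.card_pos h₁

theorem le_normalizer_of_card_eq_two_mul [Finite G] {H K : Subgroup G} (hHK : H ≤ K)
    (h : Nat.card K = 2 * Nat.card H) : K ≤ normalizer (H : Set G) :=
  (normal_subgroupOf_iff_le_normalizer hHK).mp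
    (normal_of_index_eq_two (index_subgroupOf_eq_two hHK h))

theorem mem_of_pow_three_eq_one [Finite G] {H K : Subgroup G} (hHK : H ≤ K)
    (h : Nat.card K = 2 * Nat.card H) {g : G} (hg : g ∈ K) (hg3 : g ^ 3 = 1) : g ∈ H := by
  have : (⟨g, hg⟩ : K) ^ 2 ∈ H.subgroupOf K := sq_mem_of_index_two (index_subgroupOf_eq_two hHK h) _
  have h2 : g ^ 2 ∈ H := this
  have : g = (g ^ 2) ^ 2 := by rw [← pow_mul, show 2 * 2 = 3 + 1 from rfl, pow_succ, hg3, one_mul]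
  rw [this]
  exact pow_mem h2 2

theorem exists_two_le_mul_card_of_lt [Finite G] {H K : Subgroup G} (h : H < K) :
    ∃ r, 2 ≤ r ∧ Nat.card K = Nat.card H * r := by
  obtain ⟨r, hr⟩ := card_dvd_of_le h.le
  refine ⟨r, ?_, hr⟩
  by_contra hr2
  refine h.ne (eq_of_le_of_card_ge h.le ?_)
  rw [hr]
  calc _ ≤ Nat.card H * 1 := Nat.mul_le_mul_left _ (by omega)
    _ = _ := mul_one _

/-- Three subgroups of `M` in general position whose intersection is not trivial. -/
structure IsGeneralTriple (M A B C : Subgroup G) : Prop where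
  leA : A ≤ M
  leB : B ≤ M
  leC : C ≤ M
  notA : ¬ B ⊓ C ≤ A
  notB : ¬ A ⊓ C ≤ B
  notC : ¬ A ⊓ B ≤ C
  ne_bot : A ⊓ B ⊓ C ≠ ⊥

namespace IsGeneralTriple

variable {M A B C : Subgroup G}

theorem swap (h : IsGeneralTriple M A B C) : IsGeneralTriple M A C B where
  leA := h.leA
  leB := h.leC
  leC := h.leB
  notA := inf_comm B C ▸ h.notA
  notB := h.notC
  notC := h.notB
  ne_bot := inf_right_comm A B C ▸ h.ne_bot

theorem rotate (h : IsGeneralTriple M A B C) : IsGeneralTriple M B C A where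
  leA := h.leB
  leB := h.leC
  leC := h.leA
  notA := inf_comm A C ▸ h.notB
  notB := inf_comm A B ▸ h.notC
  notC := h.notA
  ne_bot := by rw [inf_comm, ← inf_assoc]; exact h.ne_bot

theorem card_factors [Finite G] (h : IsGeneralTriple M A B C) :
    ∃ r s t, 2 ≤ Nat.card (A ⊓ B ⊓ C : Subgroup G) ∧ 2 ≤ r ∧ 2 ≤ s ∧ 2 ≤ t ∧
      Nat.card (A ⊓ B : Subgroup G) = Nat.card (A ⊓ B ⊓ C : Subgroup G) * r ∧
      Nat.card A = Nat.card (A ⊓ B : Subgroup G) * s ∧ Nat.card M = Nat.card A * t := by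
  obtain ⟨r, hr, hr'⟩ := exists_two_le_mul_card_of_lt
    (lt_of_le_not_ge (inf_le_left : A ⊓ B ⊓ C ≤ A ⊓ B) fun hle => h.notC (hle.trans inf_le_right))
  obtain ⟨s, hs, hs'⟩ := exists_two_le_mul_card_of_lt
    (lt_of_le_not_ge (inf_le_left : A ⊓ B ≤ A)
      fun hle => h.notB (inf_le_left.trans (hle.trans inf_le_right)))
  obtain ⟨t, ht, ht'⟩ := exists_two_le_mul_card_of_lt
    (lt_of_le_not_ge h.leA fun hle => h.notA ((inf_le_left.trans h.leB).trans hle))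
  have hD : 1 < Nat.card (A ⊓ B ⊓ C : Subgroup G) :=
    (one_lt_card_iff_ne_bot _).mpr h.ne_bot
  exact ⟨r, s, t, hD, hr, hs, ht, hr', hs', ht'⟩

open ArithmeticFunction in
theorem four_le_cardFactors [Finite G] (h : IsGeneralTriple M A B C) :
    4 ≤ cardFactors (Nat.card M) := by
  obtain ⟨r, s, t, hd, hr, hs, ht, hr', hs', ht'⟩ := h.card_factors
  have key : ∀ {n : ℕ}, 2 ≤ n → 1 ≤ cardFactors n := fun {n} hn => by
    by_contra hc
    have := cardFactors_eq_zero_iff_eq_zero_or_one.mp (Nat.lt_one_iff.mp (not_le.mp hc))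
    omega
  rw [ht', hs', hr', cardFactors_mul (by positivity) (by positivity),
    cardFactors_mul (by positivity) (by positivity),
    cardFactors_mul (by positivity) (by positivity)]
  have := key hd
  have := key hr
  have := key hs
  have := key ht
  omega

/-- A general triple cannot exist in a group with a subgroup of index at most two all of whose
subgroups form a chain. -/
theorem false_of_chain [Finite G] (h : IsGeneralTriple M A B C) {T : Subgroup G} (hT : T ≤ M)
    (hcard : Nat.card M ≤ 2 * Nat.card T)
    (chain : ∀ H K : Subgroup G, H ≤ T → K ≤ T → H ≤ K ∨ K ≤ H) :
    False := by
  have hmul : ∀ {a b : G}, a ∈ M → b ∈ M → a ∉ T → b ∉ T → a * b ∈ T := by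
    intro a b ha hb ha' hb'
    have hlt : T < M := lt_of_le_not_ge hT fun hle => ha' (hle ha)
    obtain ⟨r, hr, hr'⟩ := exists_two_le_mul_card_of_lt hlt
    have hpos : 0 < Nat.card T := Nat.card_pos
    have h2 := index_subgroupOf_eq_two hT (by nlinarith)
    have := (mul_mem_iff_of_index_two h2 (a := ⟨a, ha⟩) (b := ⟨b, hb⟩)).mpr (by
      simp [mem_subgroupOf, ha', hb'])
    exact this
  have key : ∀ {A B C : Subgroup G}, IsGeneralTriple M A B C → A ⊓ T ≤ B ⊓ T → B ⊓ T ≤ C ⊓ T →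
      False := by
    intro A B C h hAB hBC
    obtain ⟨c, ⟨hcA, hcB⟩, hcC⟩ := SetLike.not_le_iff_exists.mp h.notC
    obtain ⟨b, ⟨hbA, hbC⟩, hbB⟩ := SetLike.not_le_iff_exists.mp h.notB
    have hcT : c ∉ T := fun hc => hcC (hBC ⟨hcB, hc⟩).1
    have hbT : b ∉ T := fun hb => hbB (hAB ⟨hbA, hb⟩).1
    have : b * c ∈ A ⊓ T := ⟨mul_mem hbA hcA, hmul (h.leA hbA) (h.leA hcA) hbT hcT⟩
    exact hbB ((B.mul_mem_cancel_right hcB).mp (hAB this).1)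
  have hc := fun H K : Subgroup G => chain (H ⊓ T) (K ⊓ T) inf_le_right inf_le_right
  rcases hc A B with a | a <;> rcases hc B C with b | b <;> rcases hc A C with c | c
  · exact key h a b
  · exact key h a b
  · exact key h.swap c b
  · exact key h.rotate.rotate c a
  · exact key h.rotate.swap a c
  · exact key h.rotate b c
  · exact key h.swap.rotate b a
  · exact key h.swap.rotate b a

end IsGeneralTriple

theorem card_ne_six_of_card_eq_twelve [Finite G] [Finite P] {A Y : Subgroup G}
    (hA : Nat.card A = 12) (hst : ∀ z : P, Nat.card (A ⊓ stabilizer G z : Subgroup G) ≤ 3)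
    (hfix : ∀ g ∈ A, g ≠ 1 → Nat.card (fixedBy P g) = 2) (hYA : Y ≤ A) : Nat.card Y ≠ 6 := by
  intro hY
  have : Fact (Nat.Prime 3) := ⟨Nat.prime_three⟩
  obtain ⟨⟨w, hwY⟩, hw⟩ := exists_prime_orderOf_dvd_card' (G := Y) 3 (by rw [hY]; norm_num)
  rw [orderOf_mk] at hw
  have hP : Nat.card (zpowers w) = 3 := by rw [Nat.card_zpowers, hw]
  have hPY : zpowers w ≤ Y := zpowers_le.mpr hwY
  have hmem : ∀ h ∈ A, h ^ 3 = 1 → h ∈ zpowers w := fun h hh h3 =>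
    mem_of_pow_three_eq_one hPY (by omega) (mem_of_pow_three_eq_one hYA (by omega) hh h3) h3
  have hconj : ∀ a ∈ A, ∀ x ∈ zpowers w, a * x * a⁻¹ ∈ zpowers w := by
    intro a ha x hx
    refine hmem _ (mul_mem (mul_mem ha (hYA (hPY hx))) (inv_mem ha)) ?_
    have : x ^ 3 = 1 := by
      have := pow_card_eq_one' (x := (⟨x, hx⟩ : zpowers w))
      rw [hP] at this
      exact congrArg Subtype.val this
    rw [conj_pow, this, mul_one, mul_inv_cancel]
  have hn : A ≤ normalizer (zpowers w : Set G) := fun a ha =>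
    mem_normalizer_iff.mpr fun x => ⟨hconj a ha x, fun hx => by
      have := hconj a⁻¹ (inv_mem ha) _ hx
      simpa [mul_assoc] using this⟩
  obtain ⟨z, hz⟩ := card_le_of_normalizes (P := P) (hP ▸ Nat.prime_three) hn
    (fun g hg => hfix g (hYA (hPY hg)))
  have := hst z
  omega

theorem le_normalizer_of_two_subgroups [Finite G] {M X Y D : Subgroup G} (hXM : X ≤ M)
    (hYM : Y ≤ M) (hX : X ≤ normalizer (D : Set G)) (hY : Y ≤ normalizer (D : Set G))
    (hYX : ¬ Y ≤ X)
    (hn : ∀ k, 2 ≤ k → Nat.card X * k ∣ Nat.card M → Nat.card X * k = Nat.card M) :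
    M ≤ normalizer (D : Set G) := by
  obtain ⟨r, hr, hr'⟩ := exists_two_le_mul_card_of_lt
    (lt_of_le_not_ge (le_inf hXM hX : X ≤ M ⊓ normalizer (D : Set G))
      fun hle => hYX ((le_inf hYM hY).trans hle))
  have := hn r hr (hr' ▸ card_dvd_of_le inf_le_left)
  rw [← hr'] at this
  exact inf_eq_left.mp (eq_of_le_of_card_ge inf_le_left this.ge)

theorem eq_two_of_mul_eq_twelve {d r s : ℕ} (hd : 2 ≤ d) (hr : 2 ≤ r) (hs : 2 ≤ s)
    (h : 12 = d * r * s) (h6 : d * r ≠ 6) : d = 2 ∧ r = 2 := by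
  have h1 : d * r ≤ 6 := by nlinarith
  have h2 : d ≤ 3 := by nlinarith
  have h3 : r ≤ 3 := by nlinarith
  interval_cases d <;> interval_cases r <;> omega

theorem eq_two_of_mul_eq_eight {d r s : ℕ} (hd : 2 ≤ d) (hr : 2 ≤ r) (hs : 2 ≤ s)
    (h : 8 = d * r * s) : d = 2 ∧ r = 2 := by
  have h1 : d * r ≤ 4 := by nlinarith
  have h2 : d ≤ 2 := by nlinarith
  have h3 : r ≤ 2 := by nlinarith
  omega

namespace IsGeneralTriple

variable {M A B C : Subgroup G}

theorem false_of_card_eq_twelve [Finite G] [Finite P] (h : IsGeneralTriple M A B C)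
    (hA : Nat.card A = 12) (hst : ∀ z : P, Nat.card (A ⊓ stabilizer G z : Subgroup G) ≤ 3)
    (hfix : ∀ g ∈ A, g ≠ 1 → Nat.card (fixedBy P g) = 2) : False := by
  obtain ⟨r, s, t, hd, hr, hs, ht, hr', hs', ht'⟩ := h.card_factors
  obtain ⟨u, v, w, hd₂, hu, hv, hw, hu', hv', hw'⟩ := h.swap.card_factors
  have hX := card_ne_six_of_card_eq_twelve hA hst hfix (inf_le_left : A ⊓ B ≤ A)
  have hY := card_ne_six_of_card_eq_twelve hA hst hfix (inf_le_left : A ⊓ C ≤ A)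
  rw [inf_right_comm] at hd₂ hu'
  obtain ⟨h2, rfl⟩ := eq_two_of_mul_eq_twelve hd hr hs (by rw [← hr', ← hs', hA]) (hr' ▸ hX)
  obtain ⟨-, rfl⟩ := eq_two_of_mul_eq_twelve hd hu hv (by rw [← hu', ← hv', hA]) (hu' ▸ hY)
  have nX : A ⊓ B ≤ normalizer ((A ⊓ B ⊓ C : Subgroup G) : Set G) :=
    le_normalizer_of_card_eq_two_mul inf_le_left (by omega)
  have nY : A ⊓ C ≤ normalizer ((A ⊓ B ⊓ C : Subgroup G) : Set G) :=
    le_normalizer_of_card_eq_two_mul (le_inf (inf_le_left.trans inf_le_left) inf_le_right)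
      (by omega)
  have nA := le_normalizer_of_two_subgroups (inf_le_left : A ⊓ B ≤ A) inf_le_left nX nY
    (fun hle => h.notB (hle.trans inf_le_right)) (fun k hk hdvd => by
      rw [hr', h2, hA] at *
      have := Nat.le_of_dvd (by norm_num) hdvd
      have : k ≤ 3 := by omega
      interval_cases k <;> omega)
  obtain ⟨z, hz⟩ := card_le_of_normalizes (P := P) (h2 ▸ Nat.prime_two) nA
    (fun g hg => hfix g hg.1.1)
  have := hst z
  omega

theorem false_of_card_eq_twentyFour [Finite G] [Finite P] (h : IsGeneralTriple M A B C)
    (hM : Nat.card M = 24) (hA : Nat.card A = 8) (hB : Nat.card B = 8) (hC : Nat.card C = 8)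
    (hst : ∀ z : P, Nat.card (M ⊓ stabilizer G z : Subgroup G) ≤ 4)
    (hfix : ∀ g ∈ M, g ≠ 1 → Nat.card (fixedBy P g) = 2) : False := by
  obtain ⟨r, s, t, hd, hr, hs, ht, hr', hs', ht'⟩ := h.card_factors
  obtain ⟨u, v, w, hd₂, hu, hv, hw, hu', hv', hw'⟩ := h.swap.card_factors
  rw [inf_right_comm] at hd₂ hu'
  obtain ⟨h2, rfl⟩ := eq_two_of_mul_eq_eight hd hr hs (by rw [← hr', ← hs', hA])
  obtain ⟨-, rfl⟩ := eq_two_of_mul_eq_eight hd hu hv (by rw [← hu', ← hv', hA])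
  have key : ∀ {X Y D : Subgroup G}, X ≤ M → Y ≤ M → Nat.card X = 8 →
      X ≤ normalizer (D : Set G) → Y ≤ normalizer (D : Set G) → ¬ Y ≤ X →
      M ≤ normalizer (D : Set G) := fun hX hY hc nX nY hYX =>
    le_normalizer_of_two_subgroups hX hY nX nY hYX fun k hk hdvd => by
      rw [hc, hM] at *
      have := Nat.le_of_dvd (by norm_num) hdvd
      have : k ≤ 3 := by omega
      interval_cases k <;> omega
  have nAB := key h.leA h.leB hA
    (le_normalizer_of_card_eq_two_mul (inf_le_left : A ⊓ B ≤ A) (by omega))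
    (le_normalizer_of_card_eq_two_mul inf_le_right (by omega))
    (fun hle => h.notA (inf_le_left.trans hle))
  have nAC := key h.leA h.leC hA
    (le_normalizer_of_card_eq_two_mul (inf_le_left : A ⊓ C ≤ A) (by omega))
    (le_normalizer_of_card_eq_two_mul inf_le_right (by omega))
    (fun hle => h.notA (inf_le_right.trans hle))
  have nD : M ≤ normalizer ((A ⊓ B ⊓ C : Subgroup G) : Set G) := fun m hm =>
    mem_normalizer_iff.mpr fun x => by
      have h₁ := mem_normalizer_iff.mp (nAB hm) x
      have h₂ := mem_normalizer_iff.mp (nAC hm) x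
      simp only [mem_inf] at h₁ h₂ ⊢
      tauto
  obtain ⟨z, hz⟩ := card_le_of_normalizes (P := P) (h2 ▸ Nat.prime_two) nD
    (fun g hg => hfix g (h.leA hg.1.1))
  have := hst z
  omega

theorem false_of_two_fixed_points [Finite G] [Finite P] [Nonempty P] (h : IsGeneralTriple M A B C)
    {r : ℕ}
    (hr : (Nat.card M = 12 ∧ r = 3) ∨ (Nat.card M = 24 ∧ r = 4) ∨ (Nat.card M = 60 ∧ r = 5))
    (hst : ∀ z : P, Nat.card (M ⊓ stabilizer G z : Subgroup G) ≤ r)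
    (hfix : ∀ g ∈ M, g ≠ 1 → Nat.card (fixedBy P g) = 2) : False := by
  have key : ∀ {A B C : Subgroup G}, IsGeneralTriple M A B C → ¬ 2 * r < Nat.card A := by
    intro A B C h hlt
    rcases card_of_two_fixed_points (P := P) (fun g hg => hfix g (h.leA hg)) with
      ⟨z, hz⟩ | ⟨s, hs, hs'⟩
    · have := card_le_of_le (inf_le_inf_right (stabilizer G z) h.leA)
      have := hst z
      omega
    · obtain ⟨-, -, t, -, -, -, ht, -, -, ht'⟩ := h.card_factors
      rcases hs with ⟨hA, rfl⟩ | ⟨hA, rfl⟩ | ⟨hA, rfl⟩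
      · exact h.false_of_card_eq_twelve hA hs' (fun g hg => hfix g (h.leA hg))
      · rw [hA] at ht'
        omega
      · rw [hA] at ht'
        omega
  have hA := key h
  have hB := key h.rotate
  have hC := key h.rotate.rotate
  have hcard : ∀ {A B C : Subgroup G}, IsGeneralTriple M A B C → 8 ≤ Nat.card A ∧
      Nat.card A ∣ Nat.card M := fun h => by
    obtain ⟨r, s, t, hd, hr, hs, ht, hr', hs', ht'⟩ := h.card_factors
    refine ⟨?_, card_dvd_of_le h.leA⟩
    rw [hs', hr']
    exact Nat.mul_le_mul (Nat.mul_le_mul hd hr) hs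
  obtain ⟨a, a'⟩ := hcard h
  obtain ⟨b, b'⟩ := hcard h.rotate
  obtain ⟨c, c'⟩ := hcard h.rotate.rotate
  rcases hr with ⟨hM, rfl⟩ | ⟨hM, rfl⟩ | ⟨hM, rfl⟩
  · omega
  · exact h.false_of_card_eq_twentyFour hM (by omega) (by omega) (by omega) hst hfix
  · obtain ⟨r, s, t, hd, hr, hs, ht, hr', hs', ht'⟩ := h.card_factors
    have h10 : Nat.card A ≤ 10 := by omega
    rw [hs', hr'] at h10
    have h4 : 4 ≤ Nat.card (A ⊓ B ⊓ C : Subgroup G) * r := Nat.mul_le_mul hd hr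
    have : s ≤ 2 := by nlinarith
    have hdr : Nat.card (A ⊓ B ⊓ C : Subgroup G) * r ≤ 5 := by nlinarith
    have : r ≤ 2 := by nlinarith
    have : Nat.card (A ⊓ B ⊓ C : Subgroup G) ≤ 2 := by nlinarith
    have e₁ : s = 2 := by omega
    have e₂ : r = 2 := by omega
    have e₃ : Nat.card (A ⊓ B ⊓ C : Subgroup G) = 2 := by omega
    rw [hM, hs', hr', e₁, e₂, e₃] at ht'
    omega

end IsGeneralTriple
end Subgroup

end FixedPoints

section ProjectiveLine

open MulAction Matrix Matrix.SpecialLinearGroup OnePoint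
open scoped MatrixGroups

section Action

variable {F L : Type*} [Field F] [Field L] [Algebra F L] [DecidableEq L]

theorem mapGL_smul_infty_eq_self_iff (g : SL(2, F)) :
    mapGL L g • (∞ : OnePoint L) = ∞ ↔ g 1 0 = 0 := by
  simp [OnePoint.smul_infty_eq_self_iff]

theorem mapGL_smul_coe_eq_self_iff (g : SL(2, F)) (z : L) :
    mapGL L g • (z : OnePoint L) = z ↔
      algebraMap F L (g 1 0) * z ^ 2 + algebraMap F L (g 1 1 - g 0 0) * z =
        algebraMap F L (g 0 1) := by
  rw [← Matrix.GeneralLinearGroup.fixpointPolynomial_aeval_eq_zero_iff]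
  simp [Matrix.GeneralLinearGroup.fixpointPolynomial, sub_eq_zero]

variable (F L) in
/-- The action of `PSL(2, F)` on the projective line over an extension of `F`. -/
noncomputable def PSL.toPermOnePoint :
    ProjectiveSpecialLinearGroup (Fin 2) F →* Equiv.Perm (OnePoint L) :=
  QuotientGroup.lift _ ((MulAction.toPermHom (GL (Fin 2) L) (OnePoint L)).comp (mapGL L)) (by
    intro g hg
    obtain ⟨r, hr, hg⟩ := Matrix.SpecialLinearGroup.mem_center_iff.mp hg
    have h : ∀ i j, g i j = if i = j then r else 0 := fun i j => by
      rw [← hg, scalar_apply, diagonal_apply]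
    ext z
    cases z with
    | infty => exact (mapGL_smul_infty_eq_self_iff g).mpr (by simp [h])
    | coe z => exact (mapGL_smul_coe_eq_self_iff g z).mpr (by simp [h]))

noncomputable instance PSL.instMulActionOnePoint :
    MulAction (ProjectiveSpecialLinearGroup (Fin 2) F) (OnePoint L) :=
  MulAction.compHom _ (PSL.toPermOnePoint F L)

theorem PSL.mk_smul (g : SL(2, F)) (z : OnePoint L) :
    (g : ProjectiveSpecialLinearGroup (Fin 2) F) • z = mapGL L g • z := rfl

theorem PSL.mk_smul_infty_eq_self_iff (g : SL(2, F)) :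
    (g : ProjectiveSpecialLinearGroup (Fin 2) F) • (∞ : OnePoint L) = ∞ ↔ g 1 0 = 0 :=
  mapGL_smul_infty_eq_self_iff g

theorem PSL.mk_smul_coe_eq_self_iff (g : SL(2, F)) (z : L) :
    (g : ProjectiveSpecialLinearGroup (Fin 2) F) • (z : OnePoint L) = z ↔
      algebraMap F L (g 1 0) * z ^ 2 + algebraMap F L (g 1 1 - g 0 0) * z =
        algebraMap F L (g 0 1) :=
  mapGL_smul_coe_eq_self_iff g z

theorem PSL.mk_eq_one_iff (g : SL(2, F)) :
    (g : ProjectiveSpecialLinearGroup (Fin 2) F) = 1 ↔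
      g 0 1 = 0 ∧ g 1 0 = 0 ∧ g 0 0 = g 1 1 := by
  rw [QuotientGroup.eq_one_iff, Matrix.SpecialLinearGroup.mem_center_iff]
  constructor
  · rintro ⟨r, -, hg⟩
    have h : ∀ i j, g i j = if i = j then r else 0 := fun i j => by
      rw [← hg, scalar_apply, diagonal_apply]
    simp [h]
  · rintro ⟨h₁, h₂, h₃⟩
    have hdet := g.det_coe
    rw [det_fin_two, h₁, h₃] at hdet
    refine ⟨g 1 1, by simpa [sq] using hdet, ?_⟩
    ext i j
    fin_cases i <;> fin_cases j <;> simp [h₁, h₂, h₃]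

/-- Away from the parabolic case, if the discriminant is a square then there are two fixed
points. -/
theorem PSL.card_fixedBy_eq_two (h2 : (2 : L) ≠ 0) (g : SL(2, F)) {s : L} (hs : s ≠ 0)
    (htr : algebraMap F L (g 0 0 + g 1 1) ^ 2 - 4 = s ^ 2) :
    Nat.card (fixedBy (OnePoint L) (g : ProjectiveSpecialLinearGroup (Fin 2) F)) = 2 := by
  have hdet := congrArg (algebraMap F L) g.det_coe
  rw [det_fin_two] at hdet
  suffices ∃ x y, x ≠ y ∧ fixedBy (OnePoint L) (g : ProjectiveSpecialLinearGroup (Fin 2) F) =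
      {x, y} by
    obtain ⟨x, y, hxy, h⟩ := this
    rw [h, Nat.card_coe_set_eq, Set.ncard_pair hxy]
  by_cases hc0 : g 1 0 = 0
  · have hd : algebraMap F L (g 1 1) - algebraMap F L (g 0 0) ≠ 0 := by
      intro h
      apply hs
      rw [hc0] at hdet
      simp only [map_add, map_mul, map_sub, map_one, map_zero] at *
      rw [← sq_eq_zero_iff]
      linear_combination (-1 : L) * htr + 4 * hdet +
        (algebraMap F L (g 1 1) - algebraMap F L (g 0 0)) * h
    refine ⟨∞, ((algebraMap F L (g 0 1) / (algebraMap F L (g 1 1) - algebraMap F L (g 0 0)) : L) :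
      OnePoint L), by simp, ?_⟩
    ext z
    cases z with
    | infty => simp [mem_fixedBy, PSL.mk_smul_infty_eq_self_iff, hc0]
    | coe z =>
      simp only [mem_fixedBy, PSL.mk_smul_coe_eq_self_iff, hc0, Set.mem_insert_iff,
        OnePoint.coe_ne_infty, false_or, Set.mem_singleton_iff, OnePoint.coe_eq_coe,
        map_zero, zero_mul, zero_add, map_sub]
      rw [eq_div_iff hd, mul_comm]
  · have hc' : algebraMap F L (g 1 0) ≠ 0 := by simpa using hc0
    have h2c : 2 * algebraMap F L (g 1 0) ≠ 0 := mul_ne_zero h2 hc'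
    set a := algebraMap F L (g 0 0) with ha
    set b := algebraMap F L (g 0 1) with hb
    set c := algebraMap F L (g 1 0) with hc
    set d := algebraMap F L (g 1 1) with hd
    simp only [map_add, map_mul, map_sub, map_one, ← ha, ← hb, ← hc, ← hd] at hdet htr
    refine ⟨(((a - d + s) / (2 * c) : L) : OnePoint L),
      (((a - d - s) / (2 * c) : L) : OnePoint L), ?_, ?_⟩
    · intro h
      rw [OnePoint.coe_eq_coe, div_left_inj' h2c] at h
      exact hs ((mul_eq_zero.mp (by linear_combination h : 2 * s = 0)).resolve_left h2)
    · ext z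
      cases z with
      | infty => simp [mem_fixedBy, PSL.mk_smul_infty_eq_self_iff, hc0]
      | coe z =>
        simp only [mem_fixedBy, PSL.mk_smul_coe_eq_self_iff, Set.mem_insert_iff,
          Set.mem_singleton_iff, OnePoint.coe_eq_coe, map_sub, ← ha, ← hb, ← hc, ← hd]
        rw [eq_div_iff h2c, eq_div_iff h2c, ← sub_eq_zero, ← sub_eq_zero (a := z * _),
          ← sub_eq_zero (a := z * _) (b := a - d - s), ← mul_eq_zero]
        have : (z * (2 * c) - (a - d + s)) * (z * (2 * c) - (a - d - s)) =
            4 * c * (c * z ^ 2 + (d - a) * z - b) := by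
          linear_combination htr - 4 * hdet
        rw [this, mul_eq_zero, or_iff_right]
        exact mul_ne_zero (by rw [show (4 : L) = 2 * 2 by norm_num]; exact mul_ne_zero h2 h2) hc'

end Action

section Prime

variable {p : ℕ} [Fact p.Prime]

theorem GaloisField.isSquare_algebraMap (hp : p ≠ 2) (e : ZMod p) :
    IsSquare (algebraMap (ZMod p) (GaloisField p 2) e) := by
  by_cases he : e = 0
  · simp [he]
  have := Fintype.ofFinite (GaloisField p 2)
  have hodd := (Fact.out : p.Prime).odd_of_ne_two hp
  have hchar : ringChar (GaloisField p 2) ≠ 2 := by rwa [ringChar.eq (GaloisField p 2) p]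
  rw [FiniteField.isSquare_iff hchar (by simpa using he), ← Nat.card_eq_fintype_card,
    GaloisField.card p 2 two_ne_zero]
  obtain ⟨k, rfl⟩ := hodd
  have : (2 * k + 1) ^ 2 / 2 = (2 * k + 1 - 1) * (k + 1) := by
    rw [Nat.add_sub_cancel]
    have : (2 * k + 1) ^ 2 = 2 * (2 * k * (k + 1)) + 1 := by ring
    omega
  rw [this, pow_mul, ← map_pow, ZMod.pow_card_sub_one_eq_one he, map_one, one_pow]

theorem PSL.pow_eq_one_of_trace_sq_eq (hp : p ≠ 2) (g : SL(2, ZMod p))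
    (htr : (g 0 0 + g 1 1) ^ 2 = 4) : (g : PSL p) ^ p = 1 := by
  have hodd := (Fact.out : p.Prime).odd_of_ne_two hp
  have h : g 0 0 + g 1 1 = 2 * 1 ∨ g 0 0 + g 1 1 = 2 * (-1) := by
    have : (g 0 0 + g 1 1 - 2) * (g 0 0 + g 1 1 + 2) = 0 := by linear_combination htr
    rcases mul_eq_zero.mp this with h | h
    · left; linear_combination h
    · right; linear_combination h
  obtain ⟨ε, hε, hε2, hεp⟩ : ∃ ε : ZMod p, g 0 0 + g 1 1 = 2 * ε ∧ ε ^ 2 = 1 ∧ ε ^ p = ε := by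
    rcases h with h | h
    · exact ⟨1, h, by simp, by simp⟩
    · exact ⟨-1, h, by simp, by simp⟩
  have hdet := g.det_coe
  rw [det_fin_two] at hdet
  have hsq : ((g : Matrix (Fin 2) (Fin 2) (ZMod p)) - scalar (Fin 2) ε) ^ 2 = 0 := by
    rw [sq]
    ext i j
    fin_cases i <;> fin_cases j <;> simp [Matrix.mul_apply, Fin.sum_univ_two]
    · linear_combination (g 0 0) * hε - hdet + hε2
    · linear_combination (g 0 1) * hε
    · linear_combination (g 1 0) * hε
    · linear_combination (g 1 1) * hε - hdet + hε2
  have hpow := sub_pow_char_of_commute p (scalar_commute ε (fun _ => Commute.all _ _)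
    (g : Matrix (Fin 2) (Fin 2) (ZMod p))).symm
  rw [pow_eq_zero_of_le (Fact.out : p.Prime).two_le hsq, ← map_pow, hεp, eq_comm, sub_eq_zero,
    ← coe_pow] at hpow
  rw [← QuotientGroup.mk_pow, PSL.mk_eq_one_iff]
  simp [hpow]

theorem PSL.trace_sq_ne_of_not_dvd (hp : p ≠ 2) {M : Subgroup (PSL p)} (hM : ¬ p ∣ Nat.card M)
    {g : SL(2, ZMod p)} (hg : (g : PSL p) ∈ M) (hg1 : (g : PSL p) ≠ 1) :
    (g 0 0 + g 1 1) ^ 2 ≠ 4 := fun htr => by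
  have h := orderOf_eq_prime (PSL.pow_eq_one_of_trace_sq_eq hp g htr) hg1
  have := M.orderOf_dvd_natCard hg
  rw [h] at this
  exact hM this

theorem PSL.card_fixedBy_eq_two_of_mem (hp : p ≠ 2) [DecidableEq (GaloisField p 2)]
    {M : Subgroup (PSL p)} (hM : ¬ p ∣ Nat.card M) {g : PSL p} (hg : g ∈ M) (hg1 : g ≠ 1) :
    Nat.card (fixedBy (OnePoint (GaloisField p 2)) g) = 2 := by
  obtain ⟨g, rfl⟩ := QuotientGroup.mk_surjective g
  have htr := PSL.trace_sq_ne_of_not_dvd hp hM hg hg1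
  obtain ⟨s, hs⟩ := GaloisField.isSquare_algebraMap hp ((g 0 0 + g 1 1) ^ 2 - 4)
  rw [map_sub, map_pow, map_ofNat, ← sq] at hs
  refine PSL.card_fixedBy_eq_two ?_ g ?_ hs
  · exact Ring.two_ne_zero (by rwa [ringChar.eq (GaloisField p 2) p])
  · rintro rfl
    apply htr
    apply (algebraMap (ZMod p) (GaloisField p 2)).injective
    rw [map_pow, map_ofNat]
    linear_combination hs

theorem PSL.card_comap_mk (hp : p ≠ 2) (T : Subgroup (PSL p)) :
    Nat.card (T.comap (QuotientGroup.mk' _)) = 2 * Nat.card T := by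
  have hcenter : Nat.card (Subgroup.center SL(2, ZMod p)) = 2 := by
    have : (Subgroup.center SL(2, ZMod p) : Set SL(2, ZMod p)) = {1, -1} := by
      ext g
      have hdet := g.det_coe
      rw [det_fin_two] at hdet
      rw [SetLike.mem_coe, ← QuotientGroup.eq_one_iff, PSL.mk_eq_one_iff]
      constructor
      · rintro ⟨h₁, h₂, h₃⟩
        rw [h₁, h₃, zero_mul, sub_zero, mul_self_eq_one_iff] at hdet
        refine hdet.imp (fun h => ?_) (fun h => ?_)
        · ext i j
          fin_cases i <;> fin_cases j <;> simp [h₁, h₂, h₃, h]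
        · ext i j
          fin_cases i <;> fin_cases j <;> simp [h₁, h₂, h₃, h]
      · rintro (rfl | rfl) <;> simp
    rw [← SetLike.coe_sort_coe, this, Nat.card_coe_set_eq, Set.ncard_pair]
    intro h
    have h := congrFun₂ (congrArg Subtype.val h) 0 0
    have h2 : (2 : ZMod p) ≠ 0 := Ring.two_ne_zero (by rwa [ZMod.ringChar_zmod_n])
    apply h2
    simp only [coe_neg, coe_one, Matrix.neg_apply, one_apply_eq] at h
    linear_combination h
  have h₁ := (T.comap (QuotientGroup.mk' (Subgroup.center SL(2, ZMod p)))).card_mul_index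
  rw [Subgroup.index_comap_of_surjective _ (QuotientGroup.mk'_surjective _),
    Subgroup.card_eq_card_quotient_mul_card_subgroup (Subgroup.center SL(2, ZMod p)),
    ← T.card_mul_index, hcenter] at h₁
  refine Nat.eq_of_mul_eq_mul_right (Nat.pos_of_ne_zero T.index_ne_zero_of_finite) ?_
  rw [h₁]
  ring

end Prime

theorem Subgroup.le_or_le_of_isCyclic {G : Type*} [Group G] [Finite G] {T : Subgroup G}
    [IsCyclic T] {q k : ℕ} (hq : q.Prime) (hT : Nat.card T ∣ q ^ k) (H K : Subgroup G)
    (hH : H ≤ T) (hK : K ≤ T) : H ≤ K ∨ K ≤ H := by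
  have key : ∀ {H K : Subgroup G}, H ≤ T → K ≤ T → Nat.card H ∣ Nat.card K → H ≤ K := by
    intro H K hH hK hdvd h hh
    have := Fintype.ofFinite T
    classical
    have hcard := IsCyclic.card_pow_eq_one_le (α := T) (n := Nat.card K) Nat.card_pos
    have hle : Nat.card K ≤ (K.subgroupOf T : Set T).toFinset.card := by
      rw [← Nat.card_eq_card_toFinset, SetLike.coe_sort_coe, card_subgroupOf, inf_eq_left.mpr hK]
    have hsub : (K.subgroupOf T : Set T).toFinset ⊆
        Finset.univ.filter fun a : T => a ^ Nat.card K = 1 := fun x hx => by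
      rw [Set.mem_toFinset] at hx
      rw [Finset.mem_filter]
      exact ⟨Finset.mem_univ _, Subtype.ext (orderOf_dvd_iff_pow_eq_one.mp
        (K.orderOf_dvd_natCard hx))⟩
    have heq := Finset.eq_of_subset_of_card_le hsub (hcard.trans hle)
    have hmem : (⟨h, hH hh⟩ : T) ∈ Finset.univ.filter fun a : T => a ^ Nat.card K = 1 := by
      rw [Finset.mem_filter]
      exact ⟨Finset.mem_univ _, Subtype.ext (orderOf_dvd_iff_pow_eq_one.mp
        ((H.orderOf_dvd_natCard hh).trans hdvd))⟩
    rw [← heq, Set.mem_toFinset] at hmem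
    exact hmem
  obtain ⟨a, ha, ha'⟩ := (Nat.dvd_prime_pow hq).mp ((card_dvd_of_le hH).trans hT)
  obtain ⟨b, hb, hb'⟩ := (Nat.dvd_prime_pow hq).mp ((card_dvd_of_le hK).trans hT)
  rcases le_total a b with hab | hab
  · exact .inl (key hH hK (by rw [ha', hb']; exact pow_dvd_pow _ hab))
  · exact .inr (key hK hH (by rw [ha', hb']; exact pow_dvd_pow _ hab))

section Prime

variable {p : ℕ} [Fact p.Prime] {L : Type*} [Field L] [Algebra (ZMod p) L]

theorem pow_eq_one_of_quadratic [CharP L p] {t : ZMod p} {x : L}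
    (h : x ^ 2 - algebraMap (ZMod p) L t * x + 1 = 0) : x ^ (p - 1) = 1 ∨ x ^ (p + 1) = 1 := by
  have hx : x ≠ 0 := by rintro rfl; simp at h
  have hp := (Fact.out : p.Prime).one_lt
  have h' := congrArg (frobenius L p) h
  simp only [map_add, map_sub, map_mul, map_one, map_zero, frobenius_def, ← map_pow,
    ZMod.pow_card] at h'
  have : (x ^ p - x) * (x ^ p - (algebraMap (ZMod p) L t - x)) = 0 := by
    linear_combination h' - h
  rcases mul_eq_zero.mp this with h₁ | h₁
  · left
    apply mul_right_cancel₀ hx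
    rw [← pow_succ, Nat.sub_add_cancel hp.le, one_mul]
    exact sub_eq_zero.mp h₁
  · right
    rw [pow_succ]
    linear_combination x * h₁ - h

theorem isCyclic_of_eigenvalue [CharP L p] {N : Subgroup SL(2, ZMod p)} (f : N →* L)
    (hf : ∀ g : N, f g ^ 2 - algebraMap (ZMod p) L ((g : SL(2, ZMod p)) 0 0 +
      (g : SL(2, ZMod p)) 1 1) * f g + 1 = 0)
    (hN : ∀ g ∈ N, g 0 0 + g 1 1 = 2 → g = 1) :
    IsCyclic N ∧ (Nat.card N ∣ p - 1 ∨ Nat.card N ∣ p + 1) := by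
  have hinj : Function.Injective f := by
    refine (injective_iff_map_eq_one f).mpr fun g hg => Subtype.ext (hN g g.2 ?_)
    have := hf g
    rw [hg] at this
    apply (algebraMap (ZMod p) L).injective
    rw [map_ofNat]
    linear_combination -this
  have hcyc := isCyclic_of_injective_ringHom f hinj
  refine ⟨hcyc, ?_⟩
  obtain ⟨g, hg⟩ := hcyc.exists_generator
  rw [← orderOf_eq_card_of_forall_mem_zpowers hg]
  refine (pow_eq_one_of_quadratic (hf g)).imp (fun h => ?_) (fun h => ?_) <;>
  · rw [← map_pow, ← map_one f] at h
    exact orderOf_dvd_of_pow_eq_one (hinj h)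

theorem PSL.exists_eigenvalue_hom [DecidableEq L] {N : Subgroup SL(2, ZMod p)} (z : OnePoint L)
    (hz : ∀ g ∈ N, (g : PSL p) • z = z) :
    ∃ f : N →* L, ∀ g : N, f g ^ 2 - algebraMap (ZMod p) L ((g : SL(2, ZMod p)) 0 0 +
      (g : SL(2, ZMod p)) 1 1) * f g + 1 = 0 := by
  cases z with
  | infty =>
    have hc : ∀ g : N, (g : SL(2, ZMod p)) 1 0 = 0 := fun g =>
      (PSL.mk_smul_infty_eq_self_iff (L := L) _).mp (hz g g.2)
    refine ⟨⟨⟨fun g => algebraMap (ZMod p) L ((g : SL(2, ZMod p)) 1 1), by simp⟩,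
      fun g h => ?_⟩, fun g => ?_⟩
    · simp [Matrix.mul_apply, Fin.sum_univ_two, hc]
    · have hdet := congrArg (algebraMap (ZMod p) L) (g : SL(2, ZMod p)).det_coe
      rw [det_fin_two, hc] at hdet
      simp only [MonoidHom.coe_mk, OneHom.coe_mk, map_add, map_sub, map_mul, map_one, map_zero]
        at *
      linear_combination -hdet
  | coe z =>
    have hc : ∀ g : N, _ := fun g => (PSL.mk_smul_coe_eq_self_iff (L := L) _ _).mp (hz g g.2)
    refine ⟨⟨⟨fun g => algebraMap (ZMod p) L ((g : SL(2, ZMod p)) 1 0) * z +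
      algebraMap (ZMod p) L ((g : SL(2, ZMod p)) 1 1), by simp⟩,
      fun g h => ?_⟩, fun g => ?_⟩
    · have := hc h
      simp [Matrix.mul_apply, Fin.sum_univ_two] at this ⊢
      linear_combination (-algebraMap (ZMod p) L ((g : SL(2, ZMod p)) 1 0)) * this
    · have hdet := congrArg (algebraMap (ZMod p) L) (g : SL(2, ZMod p)).det_coe
      have := hc g
      rw [det_fin_two] at hdet
      simp only [MonoidHom.coe_mk, OneHom.coe_mk, map_add, map_sub, map_mul, map_one] at *
      linear_combination (algebraMap (ZMod p) L ((g : SL(2, ZMod p)) 1 0)) * this - hdet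

theorem PSL.isCyclic_inf_stabilizer (hp : p ≠ 2) [CharP L p] [DecidableEq L]
    {M : Subgroup (PSL p)} (hM : ¬ p ∣ Nat.card M) (z : OnePoint L) :
    IsCyclic (M ⊓ stabilizer (PSL p) z : Subgroup (PSL p)) ∧
      (2 * Nat.card (M ⊓ stabilizer (PSL p) z : Subgroup (PSL p)) ∣ p - 1 ∨
       2 * Nat.card (M ⊓ stabilizer (PSL p) z : Subgroup (PSL p)) ∣ p + 1) := by
  set T := M ⊓ stabilizer (PSL p) z with hT
  obtain ⟨f, hf⟩ := PSL.exists_eigenvalue_hom (N := T.comap (QuotientGroup.mk' _)) z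
    (fun g hg => hg.2)
  obtain ⟨hcyc, hcard⟩ := isCyclic_of_eigenvalue f hf fun g hg htr => by
    by_contra hne
    have h2 : (2 : ZMod p) ≠ 0 := Ring.two_ne_zero (by rwa [ZMod.ringChar_zmod_n])
    have hg1 : (g : PSL p) = 1 := by
      by_contra hg1
      exact PSL.trace_sq_ne_of_not_dvd hp hM hg.1 hg1 (by rw [htr]; norm_num)
    obtain ⟨h₁, h₂, h₃⟩ := (PSL.mk_eq_one_iff g).mp hg1
    have h₄ : g 1 1 = 1 := mul_left_cancel₀ h2 (by linear_combination htr - h₃)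
    apply hne
    ext i j
    fin_cases i <;> fin_cases j <;> simp [h₁, h₂, h₃, h₄]
  rw [PSL.card_comap_mk hp] at hcard
  refine ⟨?_, hcard⟩
  exact isCyclic_of_surjective ((QuotientGroup.mk' _).subgroupComap T)
    ((QuotientGroup.mk' _).subgroupComap_surjective_of_surjective T (QuotientGroup.mk'_surjective _))

end Prime

section Prime

variable {p : ℕ} [Fact p.Prime]

theorem transvection_mem_of_ne_zero {N : Subgroup SL(2, ZMod p)} {i j : Fin 2} (hij : i ≠ j)
    {b : ZMod p} (hb : b ≠ 0) (h : transvection hij b ∈ N) (t : ZMod p) :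
    transvection hij t ∈ N := by
  have key : ∀ n : ℕ, transvection hij ((n : ZMod p) * b) ∈ N := by
    intro n
    induction n with
    | zero => simp [N.one_mem]
    | succ n ih =>
      rw [Nat.cast_succ, add_mul, one_mul, transvection_add]
      exact mul_mem ih h
  have := key (t / b).val
  rwa [ZMod.natCast_zmod_val, div_mul_cancel₀ _ hb] at this

theorem eq_top_of_transvection_mem {N : Subgroup SL(2, ZMod p)} {b c : ZMod p} (hb : b ≠ 0)
    (hc : c ≠ 0) (hbN : transvection (zero_ne_one : (0 : Fin 2) ≠ 1) b ∈ N)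
    (hcN : transvection (one_ne_zero : (1 : Fin 2) ≠ 0) c ∈ N) : N = ⊤ := by
  refine (Subgroup.eq_top_iff' _).mpr fun x => SL2.transvection_induction (· ∈ N) ?_
    (fun _ _ => mul_mem) x
  intro i j hij t
  fin_cases i <;> fin_cases j
  · exact absurd rfl hij
  · exact transvection_mem_of_ne_zero _ hb hbN t
  · exact transvection_mem_of_ne_zero _ hc hcN t
  · exact absurd rfl hij

theorem eq_top_of_transvection_mem_of_ne_zero {N : Subgroup SL(2, ZMod p)} {b : ZMod p}
    (hb : b ≠ 0) (hbN : transvection (zero_ne_one : (0 : Fin 2) ≠ 1) b ∈ N) {h : SL(2, ZMod p)}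
    (hN : h ∈ N) (hc : h 1 0 ≠ 0) : N = ⊤ := by
  have hU := transvection_mem_of_ne_zero _ hb hbN
  have hdet := h.det_coe
  rw [det_fin_two] at hdet
  obtain ⟨J, hJ⟩ : ∃ J, J = transvection (zero_ne_one : (0 : Fin 2) ≠ 1) (-(h 0 0 / h 1 0)) * h *
    transvection (zero_ne_one : (0 : Fin 2) ≠ 1) (-(h 1 1 / h 1 0)) := ⟨_, rfl⟩
  have hJN : J ∈ N := hJ ▸ mul_mem (mul_mem (hU _) hN) (hU _)
  have hJm : (J : Matrix (Fin 2) (Fin 2) (ZMod p)) = !![0, -(h 1 0)⁻¹; h 1 0, 0] := by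
    rw [hJ, coe_mul, coe_mul, transvection_coe, transvection_coe]
    ext i j
    fin_cases i <;> fin_cases j <;>
      simp [Matrix.mul_apply, Fin.sum_univ_two, Matrix.add_apply, Matrix.one_apply, Matrix.single]
    · field_simp; ring
    · field_simp; linear_combination -hdet
    · field_simp; ring
  have hL : J * transvection (zero_ne_one : (0 : Fin 2) ≠ 1) 1 * J⁻¹ =
      transvection (one_ne_zero : (1 : Fin 2) ≠ 0) (-(h 1 0 ^ 2)) := by
    rw [mul_inv_eq_iff_eq_mul]
    apply Subtype.ext
    rw [coe_mul, coe_mul, hJm, transvection_coe, transvection_coe]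
    ext i j
    fin_cases i <;> fin_cases j <;>
      simp [Matrix.mul_apply, Fin.sum_univ_two, Matrix.add_apply, Matrix.one_apply, Matrix.single]
    field_simp
  refine eq_top_of_transvection_mem hb (neg_ne_zero.mpr (pow_ne_zero 2 hc)) hbN (hL ▸ ?_)
  exact mul_mem (mul_mem hJN (hU 1)) (inv_mem hJN)

theorem pow_apply_of_apply_one_zero_eq_zero {F : Type*} [Field F] {g : SL(2, F)}
    (hg : g 1 0 = 0) (n : ℕ) :
    (g ^ n) 1 0 = 0 ∧ (g ^ n) 0 0 = g 0 0 ^ n ∧ (g ^ n) 1 1 = g 1 1 ^ n := by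
  induction n with
  | zero => simp
  | succ n ih =>
    obtain ⟨h₁, h₂, h₃⟩ := ih
    rw [pow_succ, coe_mul]
    simp only [Matrix.mul_apply, Fin.sum_univ_two, h₁, h₂, h₃, hg, pow_succ]
    simp

theorem exists_transvection_mem (hp : p ≠ 2) {N : Subgroup SL(2, ZMod p)} {g : SL(2, ZMod p)}
    (hgN : g ∈ N) (hg : g 1 0 = 0) (hgp : (g : PSL p) ^ p = 1) (hg1 : (g : PSL p) ≠ 1) :
    ∃ b ≠ 0, transvection (zero_ne_one : (0 : Fin 2) ≠ 1) b ∈ N := by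
  have h2 : (2 : ZMod p) ≠ 0 := Ring.two_ne_zero (by rwa [ZMod.ringChar_zmod_n])
  obtain ⟨-, h₁, h₂⟩ := pow_apply_of_apply_one_zero_eq_zero hg p
  have hdet := g.det_coe
  rw [det_fin_two, hg, mul_zero, sub_zero] at hdet
  rw [← QuotientGroup.mk_pow, PSL.mk_eq_one_iff, h₁, h₂, ZMod.pow_card, ZMod.pow_card] at hgp
  have had := hgp.2.2
  have ha : g 0 0 ≠ 0 := left_ne_zero_of_mul_eq_one hdet
  refine ⟨2 * g 0 0 * g 0 1, mul_ne_zero (mul_ne_zero h2 ha) fun hb =>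
    hg1 ((PSL.mk_eq_one_iff g).mpr ⟨hb, hg, had⟩), ?_⟩
  convert pow_mem hgN 2
  apply Subtype.ext
  rw [coe_pow, sq, transvection_coe]
  ext i j
  fin_cases i <;> fin_cases j <;>
    simp [Matrix.mul_apply, Fin.sum_univ_two, Matrix.single, hg]
  · linear_combination (-had) * g 0 0 - hdet
  · linear_combination had * g 0 1
  · linear_combination had * g 1 1 - hdet

theorem PSL.exists_smul_infty_eq (F : Type*) [Field F] [DecidableEq F] (z : OnePoint F) :
    ∃ h : ProjectiveSpecialLinearGroup (Fin 2) F, h • (∞ : OnePoint F) = z := by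
  cases z with
  | infty => exact ⟨1, one_smul _ _⟩
  | coe z =>
    obtain ⟨g, hg⟩ : ∃ g : SL(2, F), (g : Matrix (Fin 2) (Fin 2) F) = !![z, -1; 1, 0] :=
      ⟨⟨!![z, -1; 1, 0], by simp [det_fin_two]⟩, rfl⟩
    refine ⟨(g : ProjectiveSpecialLinearGroup (Fin 2) F), ?_⟩
    rw [PSL.mk_smul, OnePoint.smul_infty_eq_ite]
    simp [hg]

/-- A proper subgroup of order divisible by `p` fixes a point of the projective line. -/
theorem PSL.le_stabilizer_of_dvd (hp : p ≠ 2) {M : Subgroup (PSL p)} (hM : p ∣ Nat.card M)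
    (htop : M ≠ ⊤) : ∃ z : OnePoint (ZMod p), M ≤ stabilizer (PSL p) z := by
  obtain ⟨⟨m, hmM⟩, hm⟩ := exists_prime_orderOf_dvd_card' (G := M) p hM
  rw [Subgroup.orderOf_mk] at hm
  have hpg : IsPGroup p (Subgroup.zpowers m) :=
    IsPGroup.of_card (n := 1) (by rw [Nat.card_zpowers, hm, pow_one])
  have hcard : ¬ p ∣ Nat.card (OnePoint (ZMod p)) := by
    have : Nat.card (OnePoint (ZMod p)) = p + 1 := by
      rw [show OnePoint (ZMod p) = Option (ZMod p) from rfl, Finite.card_option, Nat.card_zmod]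
    rw [this, Nat.dvd_add_right dvd_rfl]
    exact (Fact.out : p.Prime).not_dvd_one
  obtain ⟨z, hz⟩ := hpg.nonempty_fixed_point_of_prime_not_dvd_card (OnePoint (ZMod p)) hcard
  have hmz : m • z = z := hz ⟨m, Subgroup.mem_zpowers m⟩
  obtain ⟨h, rfl⟩ := PSL.exists_smul_infty_eq _ z
  refine ⟨h • (∞ : OnePoint (ZMod p)), fun x hx => ?_⟩
  by_contra hxz
  set N := (M.comap (MulAut.conj h).toMonoidHom).comap
    (QuotientGroup.mk' (Subgroup.center SL(2, ZMod p)))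
  have key : ∀ {y : PSL p}, y ∈ M → ∃ g ∈ N, (g : PSL p) = h⁻¹ * y * h := fun {y} hy => by
    obtain ⟨g, hg⟩ := QuotientGroup.mk_surjective (h⁻¹ * y * h)
    refine ⟨g, ?_, hg⟩
    change h * (g : PSL p) * h⁻¹ ∈ M
    rw [hg]
    simpa [mul_assoc] using hy
  obtain ⟨g, hgN, hg⟩ := key hmM
  obtain ⟨k, hkN, hk⟩ := key hx
  have hgz : (g : PSL p) • (∞ : OnePoint (ZMod p)) = ∞ := by
    rw [hg, mul_smul, mul_smul, hmz, inv_smul_smul]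
  have hconj : MulAut.conj h⁻¹ m = (g : PSL p) := by simp [hg]
  have hg1 : (g : PSL p) ≠ 1 := by
    rw [← hconj, Ne, MulEquiv.map_eq_one_iff]
    rintro rfl
    rw [orderOf_one] at hm
    exact (Fact.out : p.Prime).ne_one hm.symm
  have hgp : (g : PSL p) ^ p = 1 := by
    rw [← hconj, ← map_pow, orderOf_dvd_iff_pow_eq_one.mp hm.dvd, map_one]
  obtain ⟨b, hb, hbN⟩ := exists_transvection_mem hp hgN
    ((PSL.mk_smul_infty_eq_self_iff (L := ZMod p) g).mp hgz) hgp hg1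
  have hk0 : k 1 0 ≠ 0 := fun h0 => hxz <| by
    have := (PSL.mk_smul_infty_eq_self_iff (L := ZMod p) k).mpr h0
    rw [hk, mul_smul, mul_smul, inv_smul_eq_iff] at this
    exact this
  have hN := eq_top_of_transvection_mem_of_ne_zero hb hbN hkN hk0
  refine htop ((Subgroup.eq_top_iff' _).mpr fun y => ?_)
  obtain ⟨g, hg⟩ := QuotientGroup.mk_surjective (h⁻¹ * y * h)
  have hgN : g ∈ N := hN ▸ Subgroup.mem_top g
  change h * (g : PSL p) * h⁻¹ ∈ M at hgN
  rw [hg] at hgN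
  simpa [mul_assoc] using hgN

/-- The upper triangular matrices of determinant one. -/
def equivStabilizerInfty (F : Type*) [Field F] : {g : SL(2, F) // g 1 0 = 0} ≃ Fˣ × F where
  toFun g := ⟨⟨g.1 0 0, g.1 1 1, by
      have := g.1.det_coe
      rw [det_fin_two, g.2] at this
      linear_combination this, by
      have := g.1.det_coe
      rw [det_fin_two, g.2] at this
      linear_combination this⟩, g.1 0 1⟩
  invFun x := ⟨⟨!![(x.1 : F), x.2; 0, ((x.1⁻¹ : Fˣ) : F)], by simp [det_fin_two]⟩, by simp⟩
  left_inv g := by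
    ext i j
    fin_cases i <;> fin_cases j <;> simp [g.2]
  right_inv x := by
    ext <;> simp

theorem PSL.two_mul_card_stabilizer (hp : p ≠ 2) (z : OnePoint (ZMod p)) :
    2 * Nat.card (stabilizer (PSL p) z) = p * (p - 1) := by
  obtain ⟨h, rfl⟩ := PSL.exists_smul_infty_eq _ z
  rw [← Nat.card_congr (stabilizerEquivStabilizer (g := h) (a := (∞ : OnePoint (ZMod p)))
    rfl).toEquiv, ← PSL.card_comap_mk hp]
  have e : ((stabilizer (PSL p) (∞ : OnePoint (ZMod p))).comap
      (QuotientGroup.mk' (Subgroup.center SL(2, ZMod p)))) ≃ {g : SL(2, ZMod p) // g 1 0 = 0} :=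
    Equiv.subtypeEquivRight fun g => PSL.mk_smul_infty_eq_self_iff (L := ZMod p) g
  rw [Nat.card_congr (e.trans (equivStabilizerInfty _)), Nat.card_prod, Nat.card_zmod,
    Nat.card_eq_fintype_card, ZMod.card_units, mul_comm]

end Prime

/-- No proper subgroup contains three subgroups in general position with nontrivial intersection. -/
theorem PSL.not_isGeneralTriple {p : ℕ} [Fact p.Prime]
    (hp : p = 7 ∨ p = 11 ∨ p = 19 ∨ p = 31) {M A B C : Subgroup (PSL p)} (hM : M ≠ ⊤) :
    ¬ M.IsGeneralTriple A B C := by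
  classical
  intro h
  have hp2 : p ≠ 2 := by omega
  have hΩ : ∀ {n}, n ≠ 0 → Nat.card M ∣ n → 4 ≤ ArithmeticFunction.cardFactors n := by
    rintro n hn ⟨k, rfl⟩
    obtain ⟨hm, hk⟩ := mul_ne_zero_iff.mp hn
    rw [ArithmeticFunction.cardFactors_mul hm hk]
    exact h.four_le_cardFactors.trans (Nat.le_add_right _ _)
  by_cases hdvd : p ∣ Nat.card M
  · obtain ⟨z, hz⟩ := PSL.le_stabilizer_of_dvd hp2 hdvd hM
    have hc := PSL.two_mul_card_stabilizer hp2 z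
    have h4 := hΩ Nat.card_pos.ne' (Subgroup.card_dvd_of_le hz)
    rw [Nat.eq_div_of_mul_eq_right two_ne_zero hc] at h4
    rcases hp with rfl | rfl | rfl | rfl <;> simp [ArithmeticFunction.cardFactors_apply] at h4
  · have hfix : ∀ g ∈ M, g ≠ 1 → Nat.card (fixedBy (OnePoint (GaloisField p 2)) g) = 2 :=
      fun g hg hg1 => PSL.card_fixedBy_eq_two_of_mem hp2 hdvd hg hg1
    have : Finite (OnePoint (GaloisField p 2)) :=
      inferInstanceAs (Finite (Option (GaloisField p 2)))
    rcases Subgroup.card_of_two_fixed_points hfix with ⟨z, hz⟩ | ⟨r, hr, hst⟩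
    · obtain ⟨hcyc, hdiv⟩ := PSL.isCyclic_inf_stabilizer hp2 hdvd z
      have hTM : M ⊓ stabilizer (PSL p) z ≤ M := inf_le_left
      have hMdvd : Nat.card M ∣ 2 * Nat.card (M ⊓ stabilizer (PSL p) z : Subgroup (PSL p)) := by
        obtain ⟨r, hr⟩ := Subgroup.card_dvd_of_le hTM
        rw [hr, mul_comm] at hz ⊢
        have hr2 := Nat.le_of_mul_le_mul_right hz Nat.card_pos
        have hr0 : r ≠ 0 := by
          rintro rfl
          exact Nat.card_pos.ne' hr
        have hr' : r ∣ 2 := (Nat.dvd_prime Nat.prime_two).mpr (by omega)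
        exact mul_dvd_mul_right hr' _
      by_cases h16 : Nat.card (M ⊓ stabilizer (PSL p) z : Subgroup (PSL p)) ∣ 2 ^ 4
      · exact h.false_of_chain hTM hz
          (Subgroup.le_or_le_of_isCyclic Nat.prime_two h16)
      · rcases hdiv with hdiv | hdiv
        · have h4 := hΩ (by omega) (hMdvd.trans hdiv)
          rcases hp with rfl | rfl | rfl | rfl <;>
            simp [ArithmeticFunction.cardFactors_apply] at h4
        · have h4 := hΩ (by omega) (hMdvd.trans hdiv)
          rcases hp with rfl | rfl | rfl | rfl
          · simp [ArithmeticFunction.cardFactors_apply] at h4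
          · simp [ArithmeticFunction.cardFactors_apply] at h4
          · simp [ArithmeticFunction.cardFactors_apply] at h4
          · exact h16 (Nat.dvd_of_mul_dvd_mul_left two_pos hdiv)
    · exact h.false_of_two_fixed_points hr hst hfix

end ProjectiveLine

section Replacement

/-- If the replacement property fails, then three intersections of proper subgroups form a general
triple. -/
theorem ReplacementProperty.of_not_isGeneralTriple {G : Type*} [Group G]
    (hG : ∀ M A B C : Subgroup G, M ≠ ⊤ → ¬ M.IsGeneralTriple A B C) (h4 : 4 ≤ maxIrredLen G) :
    ReplacementProperty G := by
  intro g hg _ x hx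
  by_contra! hgen
  set M := fun i => Subgroup.closure (Set.range (Function.update g i x))
  have htop : ∀ i, M i ≠ ⊤ := hgen
  have hxM : ∀ i, x ∈ M i := fun i => Subgroup.subset_closure ⟨i, Function.update_self ..⟩
  have hgM : ∀ i j, j ≠ i → g j ∈ M i := fun i j hji =>
    Subgroup.subset_closure ⟨j, Function.update_of_ne hji ..⟩
  have hgM' : ∀ i, g i ∉ M i := fun i hi => htop i <| top_unique <| by
    rw [← (hg : _ = _), Subgroup.closure_le]
    rintro _ ⟨j, rfl⟩
    by_cases hji : j = i
    · exact hji ▸ hi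
    · exact hgM i j hji
  let e : Fin 4 → Fin (maxIrredLen G) := Fin.castLE h4
  have he : ∀ i j, i ≠ j → e i ≠ e j := fun i j => (Fin.castLE_injective h4).ne
  refine hG (M (e 0)) (M (e 0) ⊓ M (e 1)) (M (e 0) ⊓ M (e 2)) (M (e 0) ⊓ M (e 3)) (htop _)
    ⟨inf_le_left, inf_le_left, inf_le_left, fun h => ?_, fun h => ?_, fun h => ?_, fun h => ?_⟩
  · refine hgM' (e 1) (h (x := g (e 1)) ⟨⟨?_, ?_⟩, ?_, ?_⟩).2 <;> exact hgM _ _ (he _ _ (by decide))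
  · refine hgM' (e 2) (h (x := g (e 2)) ⟨⟨?_, ?_⟩, ?_, ?_⟩).2 <;> exact hgM _ _ (he _ _ (by decide))
  · refine hgM' (e 3) (h (x := g (e 3)) ⟨⟨?_, ?_⟩, ?_, ?_⟩).2 <;> exact hgM _ _ (he _ _ (by decide))
  · refine hx ((Subgroup.eq_bot_iff_forall _).mp h x ⟨⟨⟨?_, ?_⟩, ?_, ?_⟩, ?_, ?_⟩) <;> exact hxM _

theorem le_maxIrredLen {G : Type*} [Group G] [Finite G] {n : ℕ} {g : Fin n → G} (hg : IsGenSeq g)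
    (hirr : IsIrred g) : n ≤ maxIrredLen G := by
  refine le_csSup ⟨Nat.card G, ?_⟩ ⟨g, hg, hirr⟩
  rintro m ⟨f, hf, hfirr⟩
  have hinj : Function.Injective f := fun i j hij => by
    by_contra hne
    refine hfirr i (top_unique ?_)
    rw [← (hf : _ = _), Subgroup.closure_le]
    rintro _ ⟨k, rfl⟩
    by_cases hk : k = i
    · exact Subgroup.subset_closure ⟨j, Ne.symm hne, by rw [hk, hij]⟩
    · exact Subgroup.subset_closure ⟨k, hk, rfl⟩
  simpa using Nat.card_le_card_of_injective f hinj

end Replacement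

section Lengths

open Matrix Matrix.SpecialLinearGroup
open scoped MatrixGroups

section Examples

variable {p : ℕ} [Fact p.Prime] {n : ℕ} {g : Fin n → SL(2, ZMod p)}

theorem PSL.isGenSeq_of_prod_eq {l : List (Fin n)} {b : ZMod p} (hb : b ≠ 0)
    (hl : ((l.map g).prod : Matrix (Fin 2) (Fin 2) (ZMod p)) = !![1, b; 0, 1]) {i : Fin n}
    (hi : g i 1 0 ≠ 0) : IsGenSeq fun i => (g i : PSL p) := by
  have hmem : ∀ i, g i ∈ Subgroup.closure (Set.range g) := fun i =>
    Subgroup.subset_closure ⟨i, rfl⟩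
  have hU : transvection (zero_ne_one : (0 : Fin 2) ≠ 1) b = (l.map g).prod := by
    apply Subtype.ext
    rw [hl, transvection_coe]
    ext i j
    fin_cases i <;> fin_cases j <;> simp [Matrix.single]
  have htop := eq_top_of_transvection_mem_of_ne_zero hb
    (hU ▸ Subgroup.list_prod_mem _ fun x hx => by
      obtain ⟨j, -, rfl⟩ := List.mem_map.mp hx
      exact hmem j) (hmem i) hi
  have h := congrArg (Subgroup.map (QuotientGroup.mk' (Subgroup.center SL(2, ZMod p)))) htop
  rw [MonoidHom.map_closure, ← Set.range_comp,
    Subgroup.map_top_of_surjective _ (QuotientGroup.mk'_surjective _)] at h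
  exact h

/-- A sequence is irredundant if for each `i` there is a finite set of matrices, taken up to sign,
that is stable under conjugation by all the other entries but not by the `i`-th one. -/
theorem PSL.isIrred_of_conj_mem {S : Fin n → List (Matrix (Fin 2) (Fin 2) (ZMod p))}
    (hS : ∀ i j, j ≠ i → ∀ v ∈ S i, ∃ w ∈ S i, g j * v = w * g j ∨ g j * v = -(w * g j))
    (hS' : ∀ i, ∃ v ∈ S i, ∀ w ∈ S i, g i * v ≠ w * g i ∧ g i * v ≠ -(w * g i)) :
    IsIrred fun i => (g i : PSL p) := by
  intro i htop
  have key : ∀ x : PSL p, ∃ k : SL(2, ZMod p), (k : PSL p) = x ∧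
      ∀ v ∈ S i, ∃ w ∈ S i, (k : Matrix (Fin 2) (Fin 2) (ZMod p)) * v = w * k ∨
        (k : Matrix (Fin 2) (Fin 2) (ZMod p)) * v = -(w * k) := by
    intro x
    have hx : x ∈ Submonoid.closure ((fun i => (g i : PSL p)) '' {j | j ≠ i}) := by
      rw [← Subgroup.closure_toSubmonoid_of_finite, htop]
      trivial
    induction hx using Submonoid.closure_induction with
    | mem x hx =>
      obtain ⟨j, hj, rfl⟩ := hx
      exact ⟨g j, rfl, hS i j hj⟩
    | one => exact ⟨1, rfl, fun v hv => ⟨v, hv, Or.inl (by simp)⟩⟩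
    | mul x y _ _ hx hy =>
      obtain ⟨k, rfl, hk⟩ := hx
      obtain ⟨l, rfl, hl⟩ := hy
      refine ⟨k * l, rfl, fun v hv => ?_⟩
      obtain ⟨w, hw, hlw⟩ := hl v hv
      obtain ⟨u, hu, hku⟩ := hk w hw
      refine ⟨u, hu, ?_⟩
      rw [coe_mul, Matrix.mul_assoc, ← Matrix.mul_assoc u]
      rcases hlw with h | h <;> rcases hku with h' | h' <;>
        simp [h, ← Matrix.mul_assoc, h']
  obtain ⟨k, hk, hkS⟩ := key (g i)
  obtain ⟨r, -, hr⟩ := mem_center_iff.mp (QuotientGroup.eq.mp hk)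
  have hgk : (g i : Matrix (Fin 2) (Fin 2) (ZMod p)) = r • (k : Matrix (Fin 2) (Fin 2) (ZMod p)) := by
    rw [← mul_inv_cancel_left k (g i), coe_mul, ← hr, scalar_apply, ← smul_one_eq_diagonal,
      Matrix.mul_smul, Matrix.mul_one]
  obtain ⟨v, hv, hvS⟩ := hS' i
  obtain ⟨w, hw, h⟩ := hkS v hv
  rcases h with h | h
  · exact (hvS w hw).1 (by rw [hgk, Matrix.smul_mul, h, Matrix.mul_smul])
  · exact (hvS w hw).2 (by rw [hgk, Matrix.smul_mul, h, Matrix.mul_smul, smul_neg])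

end Examples

section NatMatrix

/-- The matrix modulo `p` with the given rows. -/
def natMatrix (p : ℕ) (s : ℕ × ℕ × ℕ × ℕ) : Matrix (Fin 2) (Fin 2) (ZMod p) :=
  !![s.1, s.2.1; s.2.2.1, s.2.2.2]

/-- The product of two `2 × 2` matrices given by their rows. -/
def natMul (s t : ℕ × ℕ × ℕ × ℕ) : ℕ × ℕ × ℕ × ℕ :=
  (s.1 * t.1 + s.2.1 * t.2.2.1, s.1 * t.2.1 + s.2.1 * t.2.2.2,
    s.2.2.1 * t.1 + s.2.2.2 * t.2.2.1, s.2.2.1 * t.2.1 + s.2.2.2 * t.2.2.2)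

variable {p : ℕ} (s t : ℕ × ℕ × ℕ × ℕ)

theorem natMatrix_mul : natMatrix p s * natMatrix p t = natMatrix p (natMul s t) := by
  simp [natMatrix, natMul]

theorem natMatrix_eq_iff : natMatrix p s = natMatrix p t ↔
    (s.1 % p = t.1 % p ∧ s.2.1 % p = t.2.1 % p) ∧
      s.2.2.1 % p = t.2.2.1 % p ∧ s.2.2.2 % p = t.2.2.2 % p := by
  simp only [← ZMod.natCast_eq_natCast_iff']
  constructor
  · intro h
    exact ⟨⟨congrFun₂ h 0 0, congrFun₂ h 0 1⟩, congrFun₂ h 1 0, congrFun₂ h 1 1⟩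
  · rintro ⟨⟨h₁, h₂⟩, h₃, h₄⟩
    simp [natMatrix, h₁, h₂, h₃, h₄]

theorem natMatrix_eq_neg_iff : natMatrix p s = -natMatrix p t ↔
    ((s.1 + t.1) % p = 0 ∧ (s.2.1 + t.2.1) % p = 0) ∧
      (s.2.2.1 + t.2.2.1) % p = 0 ∧ (s.2.2.2 + t.2.2.2) % p = 0 := by
  simp only [← Nat.dvd_iff_mod_eq_zero, ← ZMod.natCast_eq_zero_iff, Nat.cast_add,
    ← eq_neg_iff_add_eq_zero]
  constructor
  · intro h
    exact ⟨⟨congrFun₂ h 0 0, congrFun₂ h 0 1⟩, congrFun₂ h 1 0, congrFun₂ h 1 1⟩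
  · rintro ⟨⟨h₁, h₂⟩, h₃, h₄⟩
    simp [natMatrix, h₁, h₂, h₃, h₄]

theorem PSL.four_le_maxIrredLen_of_nat [Fact p.Prime] (g : Fin 4 → ℕ × ℕ × ℕ × ℕ)
    (hdet : ∀ i, ((g i).1 * (g i).2.2.2) % p = ((g i).2.1 * (g i).2.2.1 + 1) % p)
    (l : List (Fin 4)) (b : ℕ) (hb : b % p ≠ 0)
    (hl : natMatrix p ((l.map g).foldr natMul (1, 0, 0, 1)) = natMatrix p (1, b, 0, 1))
    (i : Fin 4) (hi : (g i).2.2.1 % p ≠ 0) (S : Fin 4 → List (ℕ × ℕ × ℕ × ℕ))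
    (hS : ∀ i j, j ≠ i → ∀ v ∈ S i, ∃ w ∈ S i,
      natMatrix p (natMul (g j) v) = natMatrix p (natMul w (g j)) ∨
      natMatrix p (natMul (g j) v) = -natMatrix p (natMul w (g j)))
    (hS' : ∀ i, ∃ v ∈ S i, ∀ w ∈ S i,
      natMatrix p (natMul (g i) v) ≠ natMatrix p (natMul w (g i)) ∧
      natMatrix p (natMul (g i) v) ≠ -natMatrix p (natMul w (g i))) :
    4 ≤ maxIrredLen (PSL p) := by
  let f : Fin 4 → SL(2, ZMod p) := fun i => ⟨natMatrix p (g i), by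
    have := (ZMod.natCast_eq_natCast_iff' _ _ p).mpr (hdet i)
    push_cast at this
    simp [natMatrix, det_fin_two, this]⟩
  have hf : ∀ i, (f i : Matrix (Fin 2) (Fin 2) (ZMod p)) = natMatrix p (g i) := fun _ => rfl
  refine le_maxIrredLen (g := fun i => (f i : PSL p))
    (PSL.isGenSeq_of_prod_eq (l := l) (b := (b : ZMod p)) ?_ ?_ (i := i) ?_)
    (PSL.isIrred_of_conj_mem (S := fun i => (S i).map (natMatrix p)) ?_ ?_)
  · rwa [Ne, ZMod.natCast_eq_zero_iff, Nat.dvd_iff_mod_eq_zero]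
  · have key : ∀ l : List (Fin 4), ((l.map f).prod : Matrix (Fin 2) (Fin 2) (ZMod p)) =
        natMatrix p ((l.map g).foldr natMul (1, 0, 0, 1)) := by
      intro l
      induction l with
      | nil => simp [natMatrix, Matrix.one_fin_two]
      | cons i l ih =>
        rw [List.map_cons, List.prod_cons, coe_mul, ih, hf, natMatrix_mul, List.map_cons,
          List.foldr_cons]
    rw [key, hl]
    simp [natMatrix]
  · change (((g i).2.2.1 : ℕ) : ZMod p) ≠ 0
    rwa [Ne, ZMod.natCast_eq_zero_iff, Nat.dvd_iff_mod_eq_zero]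
  · intro i j hji u hu
    obtain ⟨v, hv, rfl⟩ := List.mem_map.mp hu
    obtain ⟨w, hw, h⟩ := hS i j hji v hv
    refine ⟨_, List.mem_map_of_mem hw, ?_⟩
    rwa [hf, natMatrix_mul, natMatrix_mul]
  · intro i
    obtain ⟨v, hv, h⟩ := hS' i
    refine ⟨_, List.mem_map_of_mem hv, fun u hu => ?_⟩
    obtain ⟨w, hw, rfl⟩ := List.mem_map.mp hu
    rw [hf, natMatrix_mul, natMatrix_mul]
    exact h w hw

end NatMatrix

section Examples

instance Nat.fact_prime_seven : Fact (Nat.Prime 7) := ⟨by norm_num⟩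

theorem PSL.four_le_maxIrredLen_seven : 4 ≤ maxIrredLen (PSL 7) := by
  refine PSL.four_le_maxIrredLen_of_nat
    ![(1, 2, 6, 6), (1, 1, 5, 6), (1, 5, 1, 6), (1, 6, 2, 6)]
    (by decide +kernel) [0, 0, 0, 1, 3, 2] 1 (by decide) ?_ 0 (by decide)
    ![[(1, 4, 3, 6), (1, 5, 1, 6), (2, 6, 5, 5)],
      [(1, 4, 3, 6), (1, 6, 2, 6), (2, 2, 1, 5)],
      [(1, 2, 6, 6), (1, 3, 4, 6), (2, 1, 2, 5)],
      [(1, 1, 5, 6), (1, 3, 4, 6), (2, 5, 6, 5)]]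
    ?_ ?_ <;> simp only [natMatrix_eq_iff, natMatrix_eq_neg_iff, Ne] <;> decide +kernel

instance Nat.fact_prime_eleven : Fact (Nat.Prime 11) := ⟨by norm_num⟩

theorem PSL.four_le_maxIrredLen_eleven : 4 ≤ maxIrredLen (PSL 11) := by
  refine PSL.four_le_maxIrredLen_of_nat
    ![(0, 1, 10, 0), (1, 8, 8, 10), (0, 3, 7, 0), (3, 10, 10, 8)]
    (by decide +kernel) [0, 0, 0, 1, 2, 3] 10 (by decide) ?_ 0 (by decide)
    ![[(1, 2, 4, 10), (1, 3, 10, 10), (2, 10, 6, 9), (3, 0, 2, 8),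
       (3, 7, 0, 8), (4, 5, 3, 7)],
      [(1, 2, 2, 10), (1, 6, 8, 10), (1, 7, 10, 10), (1, 8, 6, 10),
       (1, 10, 7, 10), (4, 0, 0, 7)],
      [(0, 1, 10, 0)],
      [(1, 1, 4, 10), (1, 3, 5, 10), (1, 4, 1, 10), (1, 5, 3, 10),
       (1, 9, 9, 10), (4, 0, 0, 7)]]
    ?_ ?_ <;> simp only [natMatrix_eq_iff, natMatrix_eq_neg_iff, Ne] <;> decide +kernel

instance Nat.fact_prime_nineteen : Fact (Nat.Prime 19) := ⟨by norm_num⟩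

theorem PSL.four_le_maxIrredLen_nineteen : 4 ≤ maxIrredLen (PSL 19) := by
  refine PSL.four_le_maxIrredLen_of_nat
    ![(2, 4, 13, 17), (2, 12, 17, 17), (1, 17, 1, 18), (3, 18, 10, 16)]
    (by decide +kernel) [0, 1, 2, 0, 3] 2 (by decide) ?_ 0 (by decide)
    ![[(0, 1, 10, 0), (1, 7, 4, 18), (2, 5, 5, 17), (4, 17, 3, 15),
       (7, 16, 13, 12), (8, 11, 2, 11)],
      [(0, 5, 12, 0), (1, 8, 5, 18), (2, 18, 1, 17), (3, 16, 2, 16),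
       (5, 17, 11, 14), (9, 12, 3, 10)],
      [(1, 14, 1, 18), (1, 17, 12, 18), (3, 11, 4, 16), (4, 12, 11, 15),
       (4, 16, 13, 15), (5, 18, 10, 14)],
      [(1, 4, 3, 18), (1, 13, 17, 18), (2, 1, 9, 17), (4, 10, 13, 15),
       (4, 12, 14, 15), (8, 8, 15, 11)]]
    ?_ ?_ <;> simp only [natMatrix_eq_iff, natMatrix_eq_neg_iff, Ne] <;> decide +kernel

instance Nat.fact_prime_thirtyOne : Fact (Nat.Prime 31) := ⟨by norm_num⟩

theorem PSL.four_le_maxIrredLen_thirtyOne : 4 ≤ maxIrredLen (PSL 31) := by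
  refine PSL.four_le_maxIrredLen_of_nat
    ![(5, 24, 17, 26), (4, 6, 23, 27), (1, 29, 1, 30), (5, 1, 5, 26)]
    (by decide +kernel) [0, 1, 0, 1, 2, 3, 2] 28 (by decide) ?_ 0 (by decide)
    ![[(1, 28, 5, 30), (3, 23, 30, 28), (10, 12, 6, 21)],
      [(2, 28, 6, 29), (5, 23, 1, 26), (9, 12, 5, 22)],
      [(2, 18, 21, 29), (2, 26, 5, 29), (5, 15, 30, 26), (6, 25, 25, 25),
       (6, 28, 19, 25), (15, 1, 2, 16)],
      [(0, 2, 1, 0), (1, 15, 29, 30), (4, 8, 6, 27), (8, 0, 10, 23),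
       (9, 27, 12, 22), (11, 30, 26, 20)]]
    ?_ ?_ <;> simp only [natMatrix_eq_iff, natMatrix_eq_neg_iff, Ne] <;> decide +kernel

end Examples

end Lengths

theorem psl_replacement_property_of_small (p : ℕ) [Fact p.Prime]
    (hp : p = 7 ∨ p = 11 ∨ p = 19 ∨ p = 31) :
    ReplacementProperty (PSL p) := by
  refine .of_not_isGeneralTriple (fun M A B C hM => PSL.not_isGeneralTriple hp hM) ?_
  rcases hp with rfl | rfl | rfl | rfl
  · exact PSL.four_le_maxIrredLen_seven
  · exact PSL.four_le_maxIrredLen_eleven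
  · exact PSL.four_le_maxIrredLen_nineteen
  · exact PSL.four_le_maxIrredLen_thirtyOne
end

section
/- Let p be a prime with p > 5. Every witness to failure g for PSL(2,p) has order 2 or order 3; moreover, if p % 10 ∉ {1, 9} (i.e., p ≢ ±1 mod 10), then every witness to failure has order 2. -/
theorem orbit_size_cases (N a b c e f g : ℕ) (he : 3 ≤ e) (hf : 2 ≤ f) (hg : 2 ≤ g)
    (h1 : a * e = N) (h2 : b * f = N) (h3 : c * g = N) (hN : 3 ≤ N) (hs : a + b + c = N + 2) :
    a = 2 ∨ (e = 3 ∧ (N = 12 ∨ N = 24 ∨ N = 60)) ∨ (e = 4 ∧ N = 24) ∨ (e = 5 ∧ N = 60) := by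
  wlog hfg : f ≤ g generalizing b c f g
  · exact this c b g f hg hf h3 h2 (by omega) (by omega)
  have ha : 0 < a := by rcases Nat.eq_zero_or_pos a with h | h <;> [(subst h; omega); exact h]
  have hb : 0 < b := by rcases Nat.eq_zero_or_pos b with h | h <;> [(subst h; omega); exact h]
  have hc : 0 < c := by rcases Nat.eq_zero_or_pos c with h | h <;> [(subst h; omega); exact h]
  have hf2 : f = 2 := by
    by_contra h
    have : 3 ≤ f := by omega
    nlinarith
  subst hf2
  rcases eq_or_lt_of_le hg with h | h
  · subst h; omega
  · have h4 : e ≤ 5 := by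
      by_contra h'
      have : 6 ≤ e := by omega
      nlinarith
    have h5 : g ≤ 5 := by
      by_contra h'
      have : 6 ≤ g := by omega
      nlinarith
    interval_cases e <;> interval_cases g <;> omega

section

open MulAction

theorem pole_dichotomy_of_finite {H Y : Type*} [Group H] [Finite H] [Finite Y] [MulAction H Y]
    (hfix : ∀ h : H, h ≠ 1 → (fixedBy Y h).ncard = 2)
    (hstab : ∀ y : Y, stabilizer H y ≠ ⊥)
    (x : H) (hx : 3 ≤ orderOf x) (P : Y) (hP : x • P = P) :
    (∀ h : H, ∀ R ∈ fixedBy Y x, h • R ∈ fixedBy Y x) ∨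
      (Nat.card (stabilizer H P) = orderOf x ∧
        ((orderOf x = 3 ∧ (Nat.card H = 12 ∨ Nat.card H = 24 ∨ Nat.card H = 60)) ∨
          (orderOf x = 4 ∧ Nat.card H = 24) ∨ (orderOf x = 5 ∧ Nat.card H = 60))) := by
  classical
  have := Fintype.ofFinite H
  have := Fintype.ofFinite Y
  have hx1 : x ≠ 1 := by rintro rfl; simp at hx
  have hxs : x ∈ stabilizer H P := hP
  have hdvd : orderOf x ∣ Nat.card (stabilizer H P) := by
    rw [← Nat.card_zpowers]
    exact Subgroup.card_dvd_of_le (Subgroup.zpowers_le.2 hxs)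
  have hxle : orderOf x ≤ Nat.card (stabilizer H P) := Nat.le_of_dvd Nat.card_pos hdvd
  have hN : Nat.card (stabilizer H P) ≤ Nat.card H :=
    Nat.le_of_dvd Nat.card_pos (Subgroup.card_subgroup_dvd_card _)
  have hos : ∀ y : Y, Nat.card (orbit H y) * Nat.card (stabilizer H y) = Nat.card H := fun y ↦ by
    simpa using card_orbit_mul_card_stabilizer_eq_card_group H y
  have hs2 : ∀ y : Y, 2 ≤ Nat.card (stabilizer H y) := fun y ↦
    (Subgroup.one_lt_card_iff_ne_bot _).2 (hstab y)
  have hburn := sum_card_fixedBy_eq_card_orbits_mul_card_group H Y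
  rw [← Finset.add_sum_erase _ _ (Finset.mem_univ (1 : H)),
    Finset.sum_congr rfl (g := fun _ ↦ 2) (fun h hh ↦ by
      rw [← Nat.card_eq_fintype_card]
      exact hfix h (Finset.ne_of_mem_erase hh))] at hburn
  have h1 : Fintype.card (fixedBy Y (1 : H)) = Nat.card Y := by
    rw [← Nat.card_eq_fintype_card, fixedBy_one_eq_univ]
    exact Nat.card_congr (Equiv.Set.univ Y)
  rw [h1, Finset.sum_const, Finset.card_erase_of_mem (Finset.mem_univ _), Finset.card_univ,
    ← Nat.card_eq_fintype_card, ← Nat.card_eq_fintype_card, smul_eq_mul] at hburn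
  have hY : Nat.card Y = ∑ ω : orbitRel.Quotient H Y, Nat.card ω.orbit := by
    rw [Nat.card_congr (selfEquivSigmaOrbits' H Y), Nat.card_sigma]
  have horb : ∀ y : Y, Nat.card (orbitRel.Quotient.orbit (⟦y⟧ : orbitRel.Quotient H Y)) =
      Nat.card (orbit H y) := fun y ↦ rfl
  have horb2 : ∀ ω : orbitRel.Quotient H Y, 2 * Nat.card ω.orbit ≤ Nat.card H := by
    intro ω
    induction ω using Quotient.inductionOn with | h y =>
    rw [horb, ← hos y, mul_comm]
    exact Nat.mul_le_mul_left _ (hs2 y)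
  have hYle : 2 * Nat.card Y ≤ Nat.card (orbitRel.Quotient H Y) * Nat.card H := by
    rw [hY, Finset.mul_sum, Nat.card_eq_fintype_card (α := orbitRel.Quotient H Y)]
    exact (Finset.sum_le_card_nsmul _ _ _ fun ω _ ↦ horb2 ω)
  have hfY : (fixedBy Y x).ncard = 2 := hfix x hx1
  have hYge : 2 ≤ Nat.card Y := hfY ▸ Set.ncard_le_card _
  generalize hk : Nat.card (orbitRel.Quotient H Y) = k at *
  generalize hNN : Nat.card H = N at *
  have hk4 : k < 4 := by
    by_contra h
    have : 4 * N ≤ k * N := Nat.mul_le_mul_right _ (by omega)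
    omega
  have hk2 : 2 ≤ k := by
    by_contra h
    interval_cases k <;> omega
  obtain rfl | rfl : k = 2 ∨ k = 3 := by omega
  · left
    have : fixedBy Y x = Set.univ := by
      apply Set.eq_of_subset_of_ncard_le (Set.subset_univ _)
      rw [Set.ncard_univ]
      omega
    simp [this]
  · rw [Nat.card_eq_fintype_card, Fintype.card, Finset.card_eq_three] at hk
    obtain ⟨ω₁, ω₂, ω₃, h12, h13, h23, huniv⟩ := hk
    obtain ⟨b, c, hbc⟩ : ∃ b c : Y,
        Nat.card Y = Nat.card (orbit H P) + Nat.card (orbit H b) + Nat.card (orbit H c) := by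
      rw [hY, huniv, Finset.sum_insert (by simp [h12, h13]), Finset.sum_pair h23]
      have hPm : (⟦P⟧ : orbitRel.Quotient H Y) ∈ (Finset.univ : Finset _) := Finset.mem_univ _
      rw [huniv] at hPm
      induction ω₁ using Quotient.inductionOn with | h y₁ =>
      induction ω₂ using Quotient.inductionOn with | h y₂ =>
      induction ω₃ using Quotient.inductionOn with | h y₃ =>
      simp only [Finset.mem_insert, Finset.mem_singleton] at hPm
      rcases hPm with h | h | h
      · exact ⟨y₂, y₃, by rw [← h]; simp only [horb]; ring⟩
      · exact ⟨y₁, y₃, by rw [← h]; simp only [horb]; ring⟩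
      · exact ⟨y₁, y₂, by rw [← h]; simp only [horb]; ring⟩
    rcases orbit_size_cases N _ _ _ _ _ _ (hx.trans hxle) (hs2 b) (hs2 c) (hos P)
      (hos b) (hos c) (by omega)
      (by omega) with h | h
    · left
      have hidx : (stabilizer H P).index = 2 := by
        rw [index_stabilizer]; exact h
      have hnorm : (stabilizer H P).Normal := Subgroup.normal_of_index_eq_two hidx
      have hsub : orbit H P ⊆ fixedBy Y x := by
        rintro _ ⟨h, rfl⟩
        have := hnorm.conj_mem x hxs h⁻¹
        rw [mem_stabilizer_iff, inv_inv, mul_smul, mul_smul, inv_smul_eq_iff] at this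
        exact this
      have heq : orbit H P = fixedBy Y x :=
        Set.eq_of_subset_of_ncard_le hsub (by rw [hfY]; exact h.ge)
      intro h R hR
      rw [← heq] at hR ⊢
      exact (orbit_eq_iff.2 hR) ▸ mem_orbit R h
    · right
      have : Nat.card (stabilizer H P) = orderOf x := by
        generalize Nat.card (stabilizer H P) = e at *
        obtain ⟨d, rfl⟩ := hdvd
        rcases d with _ | _ | d
        · omega
        · simp
        · have : orderOf x * 2 ≤ orderOf x * (d + 1 + 1) := Nat.mul_le_mul_left _ (by omega)
          omega
      rw [this] at h
      exact ⟨this, h⟩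

theorem pole_dichotomy {H X : Type*} [Group H] [Finite H] [MulAction H X]
    (hfix : ∀ h : H, h ≠ 1 → (fixedBy X h).ncard = 2)
    (x : H) (hx : 3 ≤ orderOf x) (P : X) (hP : x • P = P) :
    (∀ h : H, ∀ R ∈ fixedBy X x, h • R ∈ fixedBy X x) ∨
      (Nat.card (stabilizer H P) = orderOf x ∧
        ((orderOf x = 3 ∧ (Nat.card H = 12 ∨ Nat.card H = 24 ∨ Nat.card H = 60)) ∨
          (orderOf x = 4 ∧ Nat.card H = 24) ∨ (orderOf x = 5 ∧ Nat.card H = 60))) := by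
  have hx1 : x ≠ 1 := by rintro rfl; simp at hx
  let Y : SubMulAction H X :=
    { carrier := {y | ∃ h : H, h ≠ 1 ∧ h • y = y}
      smul_mem' := by
        rintro g y ⟨h, h1, hy⟩
        exact ⟨g * h * g⁻¹, by simpa using h1, by simp [mul_smul, hy]⟩ }
  have hY : ((Y : Set X)).Finite := by
    have : (Y : Set X) ⊆ ⋃ h : {h : H // h ≠ 1}, fixedBy X h.1 := by
      rintro y ⟨h, h1, hy⟩
      exact Set.mem_iUnion.2 ⟨⟨h, h1⟩, hy⟩
    exact (Set.finite_iUnion fun h : {h : H // h ≠ 1} ↦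
      Set.finite_of_ncard_pos (by rw [hfix h.1 h.2]; norm_num)).subset this
  have : Finite Y := hY
  have himg : ∀ h : H, h ≠ 1 → (fun y : Y ↦ (y : X)) '' fixedBy Y h = fixedBy X h := by
    intro h h1
    ext y
    constructor
    · rintro ⟨y, hy, rfl⟩
      exact congrArg Subtype.val hy
    · intro hy
      exact ⟨⟨y, h, h1, hy⟩, Subtype.ext hy, rfl⟩
  have key := pole_dichotomy_of_finite (Y := Y)
    (fun h h1 ↦ by
      rw [← hfix h h1, ← himg h h1, Set.ncard_image_of_injective _ Subtype.val_injective])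
    (fun y ↦ by
      obtain ⟨y, h, h1, hy⟩ := y
      exact fun hb ↦ h1 ((Subgroup.eq_bot_iff_forall _).1 hb h (Subtype.ext hy)))
    x hx ⟨P, x, hx1, hP⟩ (Subtype.ext hP)
  rw [SubMulAction.stabilizer_of_subMul] at key
  refine key.imp_left fun hk h R hR ↦ ?_
  exact congrArg Subtype.val (hk h ⟨R, x, hx1, hR⟩ (Subtype.ext hR))

/-- The subgroup `H` neither fixes a fixed point of `x` nor preserves the set of these points, the
elements of `H` fixing one of them are the powers of `x`, and the order of `H` is that of a
polyhedral rotation group. -/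
structure IsExceptional {G : Type*} (X : Type*) [Group G] [MulAction G X] (x : G)
    (H : Subgroup G) : Prop where
  not_fixes : ¬ ∃ R ∈ fixedBy X x, ∀ h ∈ H, h • R = R
  not_preserves : ¬ ∀ h ∈ H, ∀ R ∈ fixedBy X x, h • R ∈ fixedBy X x
  mem_zpowers : ∀ R ∈ fixedBy X x, ∀ h ∈ H, h • R = R → h ∈ Subgroup.zpowers x
  card_eq : (orderOf x = 3 ∧ (Nat.card H = 12 ∨ Nat.card H = 24 ∨ Nat.card H = 60)) ∨
    (orderOf x = 4 ∧ Nat.card H = 24) ∨ (orderOf x = 5 ∧ Nat.card H = 60)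

theorem eq_or_eq_of_ncard_eq_two {X : Type*} {S : Set X} (hS : S.ncard = 2) {P Q : X} (hP : P ∈ S)
    (hQ : Q ∈ S) (hPQ : P ≠ Q) {R : X} (hR : R ∈ S) : R = P ∨ R = Q := by
  obtain ⟨A, B, -, rfl⟩ := Set.ncard_eq_two.1 hS
  simp only [Set.mem_insert_iff, Set.mem_singleton_iff] at *
  grind

theorem exists_smul_notMem_of_ncard_eq_two {G X : Type*} [Group G] [IsSimpleGroup G]
    [MulAction G X] (hnofix : ∀ R : X, ∃ g : G, g • R ≠ R)
    (hcard : 2 < Nat.card G) {S : Set X} (hS : S.ncard = 2) :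
    ∃ g : G, ∃ R ∈ S, g • R ∉ S := by
  by_contra! hcon
  let Y : SubMulAction G X := ⟨S, fun g {R} hR ↦ hcon g R hR⟩
  have : Finite Y := Set.finite_of_ncard_pos (s := S) (by omega)
  have hY : Nat.card Y = 2 := hS
  obtain ⟨R, hR⟩ : S.Nonempty := Set.nonempty_of_ncard_ne_zero (by omega)
  rcases (inferInstance : (toPermHom G Y).ker.Normal).eq_bot_or_eq_top with h | h
  · have := Nat.card_le_card_of_injective _ ((MonoidHom.ker_eq_bot_iff _).1 h)
    rw [Nat.card_perm, hY] at this
    simp at this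
    omega
  · obtain ⟨g, hg⟩ := hnofix R
    have hgk : g ∈ (toPermHom G Y).ker := h ▸ Subgroup.mem_top g
    have := congrArg (fun σ : Equiv.Perm Y ↦ (σ ⟨R, hR⟩ : X)) hgk
    exact hg this

section

variable {G X : Type*} [Group G] [Finite G] [MulAction G X]

theorem isExceptional_of_not_fixes_of_not_preserves
    (hfix : ∀ g : G, g ≠ 1 → (fixedBy X g).ncard = 1 ∨ (fixedBy X g).ncard = 2)
    (hpar : ∀ H : Subgroup G, H ≠ ⊤ → ∀ u ∈ H, (fixedBy X u).ncard = 1 →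
      ∃ R : X, ∀ h ∈ H, h • R = R)
    {x : G} (hx : 3 ≤ orderOf x) {H : Subgroup G} (hH : H ≠ ⊤) (hxH : x ∈ H)
    (h₁ : ¬ ∃ R ∈ fixedBy X x, ∀ h ∈ H, h • R = R)
    (h₂ : ¬ ∀ h ∈ H, ∀ R ∈ fixedBy X x, h • R ∈ fixedBy X x) :
    IsExceptional X x H := by
  have hfix2 : ∀ h : H, h ≠ 1 → (fixedBy X h).ncard = 2 := by
    intro h hh
    refine (hfix h (by simpa using hh)).resolve_left fun hu ↦ h₁ ?_
    obtain ⟨R, hR⟩ := hpar H hH h h.2 hu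
    exact ⟨R, hR x hxH, hR⟩
  have key := fun R hR ↦ (pole_dichotomy (X := X) hfix2 ⟨x, hxH⟩ (by simpa using hx) R
    hR).resolve_left (fun hk ↦ h₂ fun h hh R hR ↦ hk ⟨h, hh⟩ R hR)
  have hne : (fixedBy X x).Nonempty := by
    apply Set.nonempty_of_ncard_ne_zero
    have := hfix x (by rintro rfl; simp at hx)
    omega
  obtain ⟨P, hP⟩ := hne
  refine ⟨h₁, h₂, fun R hR h hh hhR ↦ ?_, by simpa using (key P hP).2⟩
  have hle : Subgroup.zpowers (⟨x, hxH⟩ : H) ≤ stabilizer H R := Subgroup.zpowers_le.2 hR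
  have heq := Subgroup.eq_of_le_of_card_ge hle
    (by rw [Nat.card_zpowers]; exact (key R hR).1.le)
  have : (⟨h, hh⟩ : H) ∈ Subgroup.zpowers (⟨x, hxH⟩ : H) := heq ▸ hhR
  obtain ⟨k, hk⟩ := this
  exact ⟨k, congrArg Subtype.val hk⟩

variable [IsSimpleGroup G]

/-- Two exceptional subgroups meeting in a third one, unless they have order `60`. -/
theorem card_eq_sixty_of_isExceptional_inf {x : G} {M₁ M₂ : Subgroup G}
    (h₁ : IsCoatom M₁) (h₂ : IsCoatom M₂) (hne : M₁ ≠ M₂)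
    (hM₁ : IsExceptional X x M₁) (hM₂ : IsExceptional X x M₂)
    (hK : IsExceptional X x (M₁ ⊓ M₂)) :
    orderOf x = 3 ∧ (Nat.card M₁ = 60 ∨ Nat.card M₂ = 60) := by
  have hlt₁ : Nat.card (M₁ ⊓ M₂ : Subgroup G) < Nat.card M₁ := by
    refine lt_of_not_ge fun h ↦ hne ?_
    have := inf_eq_left.1 (Subgroup.eq_of_le_of_card_ge inf_le_left h)
    exact ((h₁.le_iff.1 this).resolve_left h₂.1).symm
  have hlt₂ : Nat.card (M₁ ⊓ M₂ : Subgroup G) < Nat.card M₂ := by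
    refine lt_of_not_ge fun h ↦ hne ?_
    have := inf_eq_right.1 (Subgroup.eq_of_le_of_card_ge inf_le_right h)
    exact (h₂.le_iff.1 this).resolve_left h₁.1
  have hd₁ : Nat.card (M₁ ⊓ M₂ : Subgroup G) ∣ Nat.card M₁ := Subgroup.card_dvd_of_le inf_le_left
  have hd₂ : Nat.card (M₁ ⊓ M₂ : Subgroup G) ∣ Nat.card M₂ := Subgroup.card_dvd_of_le inf_le_right
  by_contra hcon
  obtain ⟨hK12, h24₁, h24₂⟩ : Nat.card (M₁ ⊓ M₂ : Subgroup G) = 12 ∧ Nat.card M₁ = 24 ∧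
      Nat.card M₂ = 24 := by
    have c₁ := hM₁.card_eq
    have c₂ := hM₂.card_eq
    have c₃ := hK.card_eq
    omega
  have hnorm : ∀ M : Subgroup G, M₁ ⊓ M₂ ≤ M → Nat.card M = 24 →
      M ≤ Subgroup.normalizer ((M₁ ⊓ M₂ : Subgroup G) : Set G) := by
    intro M hle hM
    rw [← Subgroup.normal_subgroupOf_iff_le_normalizer hle]
    apply Subgroup.normal_of_index_eq_two
    have h' := Subgroup.card_mul_index ((M₁ ⊓ M₂).subgroupOf M)
    rw [Nat.card_congr (Subgroup.subgroupOfEquivOfLe hle).toEquiv, hK12, hM] at h'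
    omega
  have n₁ := hnorm M₁ inf_le_left h24₁
  have n₂ := hnorm M₂ inf_le_right h24₂
  have htop : Subgroup.normalizer ((M₁ ⊓ M₂ : Subgroup G) : Set G) = ⊤ := by
    rcases h₁.le_iff.1 n₁ with h | h
    · exact h
    · rw [h] at n₂
      exact absurd ((h₂.le_iff.1 n₂).resolve_left h₁.1) hne
  rw [Subgroup.normalizer_eq_top_iff] at htop
  rcases htop.eq_bot_or_eq_top with h | h
  · rw [h] at hK12; simp at hK12
  · exact h₁.1 (top_le_iff.1 (h ▸ inf_le_left))

theorem orderOf_eq_three_of_isExceptional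
    (hfix : ∀ g : G, g ≠ 1 → (fixedBy X g).ncard = 1 ∨ (fixedBy X g).ncard = 2)
    (hpar : ∀ H : Subgroup G, H ≠ ⊤ → ∀ u ∈ H, (fixedBy X u).ncard = 1 →
      ∃ R : X, ∀ h ∈ H, h • R = R)
    {x : G} (hx : 3 ≤ orderOf x) (hx2 : (fixedBy X x).ncard = 2)
    {M₁ M₂ M₃ : Subgroup G} (h₁ : IsCoatom M₁) (h₂ : IsCoatom M₂) (h₃ : IsCoatom M₃)
    (hx₁ : x ∈ M₁) (hx₂ : x ∈ M₂) (hx₃ : x ∈ M₃) {b c : G}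
    (hb₁ : b ∈ M₁) (hb₂ : b ∉ M₂) (hb₃ : b ∈ M₃) (hc₁ : c ∈ M₁) (hc₂ : c ∈ M₂) (hc₃ : c ∉ M₃)
    (hM₁ : IsExceptional X x M₁) :
    orderOf x = 3 ∧ ∃ H : Subgroup G, Nat.card H = 60 := by
  have hz₂ : Subgroup.zpowers x ≤ M₂ := Subgroup.zpowers_le.2 hx₂
  have hz₃ : Subgroup.zpowers x ≤ M₃ := Subgroup.zpowers_le.2 hx₃
  have aux : ∀ M : Subgroup G, IsCoatom M → x ∈ M → M ≠ M₁ → ∀ a ∈ M₁ ⊓ M, a ∉ Subgroup.zpowers x →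
      (∀ h ∈ M₁ ⊓ M, ∀ R ∈ fixedBy X x, h • R ∈ fixedBy X x) ∨
        (orderOf x = 3 ∧ ∃ H : Subgroup G, Nat.card H = 60) := by
    intro M hM hxM hne a ha haz
    by_cases hp : ∀ h ∈ M₁ ⊓ M, ∀ R ∈ fixedBy X x, h • R ∈ fixedBy X x
    · exact .inl hp
    right
    have hnf : ¬ ∃ R ∈ fixedBy X x, ∀ h ∈ M₁ ⊓ M, h • R = R := by
      rintro ⟨R, hR, hRf⟩
      exact haz (hM₁.mem_zpowers R hR a ha.1 (hRf a ha))
    have hK := isExceptional_of_not_fixes_of_not_preserves hfix hpar hx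
      (fun h ↦ h₁.1 (top_le_iff.1 (h ▸ inf_le_left))) ⟨hx₁, hxM⟩ hnf hp
    have hME := isExceptional_of_not_fixes_of_not_preserves hfix hpar hx hM.1 hxM
      (fun ⟨R, hR, hRf⟩ ↦ hnf ⟨R, hR, fun h hh ↦ hRf h hh.2⟩) (fun h ↦ hp fun a ha ↦ h a ha.2)
    obtain ⟨h3, h60 | h60⟩ := card_eq_sixty_of_isExceptional_inf h₁ hM hne.symm hM₁ hME hK
    · exact ⟨h3, _, h60⟩
    · exact ⟨h3, _, h60⟩
  have hbz : b ∉ Subgroup.zpowers x := fun h ↦ hb₂ (hz₂ h)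
  have hcz : c ∉ Subgroup.zpowers x := fun h ↦ hc₃ (hz₃ h)
  rcases aux M₂ h₂ hx₂ (fun h ↦ hb₂ (h ▸ hb₁)) c ⟨hc₁, hc₂⟩ hcz with hp₂ | h
  swap
  · exact h
  rcases aux M₃ h₃ hx₃ (fun h ↦ hc₃ (h ▸ hc₁)) b ⟨hb₁, hb₃⟩ hbz with hp₃ | h
  swap
  · exact h
  exfalso
  obtain ⟨P, hP⟩ : (fixedBy X x).Nonempty := Set.nonempty_of_ncard_ne_zero (by omega)
  have hbP : b • P ≠ P := fun h ↦ hbz (hM₁.mem_zpowers P hP b hb₁ h)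
  have hcP : c • P ≠ P := fun h ↦ hcz (hM₁.mem_zpowers P hP c hc₁ h)
  have hbc : b • P = c • P := (eq_or_eq_of_ncard_eq_two hx2 hP (hp₂ c ⟨hc₁, hc₂⟩ P hP) hcP.symm
    (hp₃ b ⟨hb₁, hb₃⟩ P hP)).resolve_left hbP
  have hmem := hM₁.mem_zpowers P hP (c⁻¹ * b) (mul_mem (inv_mem hc₁) hb₁)
    (by rw [mul_smul, hbc, inv_smul_smul])
  exact hb₂ ((Subgroup.mul_mem_cancel_left _ (inv_mem hc₂)).1 (hz₂ hmem))

open Pointwise in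
theorem orderOf_eq_three_of_coatoms
    (hfix : ∀ g : G, g ≠ 1 → (fixedBy X g).ncard = 1 ∨ (fixedBy X g).ncard = 2)
    (hpar : ∀ H : Subgroup G, H ≠ ⊤ → ∀ u ∈ H, (fixedBy X u).ncard = 1 →
      ∃ R : X, ∀ h ∈ H, h • R = R)
    (hnofix : ∀ R : X, ∃ g : G, g • R ≠ R)
    {x : G} (hx : 3 ≤ orderOf x) {M₁ M₂ M₃ : Subgroup G}
    (h₁ : IsCoatom M₁) (h₂ : IsCoatom M₂) (h₃ : IsCoatom M₃)
    (hx₁ : x ∈ M₁) (hx₂ : x ∈ M₂) (hx₃ : x ∈ M₃) {a b c : G}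
    (ha₁ : a ∉ M₁) (ha₂ : a ∈ M₂) (ha₃ : a ∈ M₃)
    (hb₁ : b ∈ M₁) (hb₂ : b ∉ M₂) (hb₃ : b ∈ M₃)
    (hc₁ : c ∈ M₁) (hc₂ : c ∈ M₂) (hc₃ : c ∉ M₃) :
    orderOf x = 3 ∧ ∃ H : Subgroup G, Nat.card H = 60 := by
  have hstab : ∀ M : Subgroup G, IsCoatom M → ∀ R : X, (∀ h ∈ M, h • R = R) →
      M = stabilizer G R := by
    intro M hM R hR
    refine ((hM.le_iff.1 (show M ≤ stabilizer G R from hR)).resolve_left fun h ↦ ?_).symm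
    obtain ⟨g, hg⟩ := hnofix R
    exact hg (show g ∈ stabilizer G R from h ▸ Subgroup.mem_top g)
  rcases hfix x (by rintro rfl; simp at hx) with hx1 | hx2
  · exfalso
    obtain ⟨R, hR⟩ := Set.ncard_eq_one.1 hx1
    have : ∀ M : Subgroup G, IsCoatom M → x ∈ M → M = stabilizer G R := by
      intro M hM hxM
      obtain ⟨R', hR'⟩ := hpar M hM.1 x hxM hx1
      have : R' ∈ fixedBy X x := hR' x hxM
      rw [hR, Set.mem_singleton_iff] at this
      exact this ▸ hstab M hM R' hR'
    exact ha₁ (this M₁ h₁ hx₁ ▸ this M₂ h₂ hx₂ ▸ ha₂)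
  by_cases e₁ : IsExceptional X x M₁
  · exact orderOf_eq_three_of_isExceptional hfix hpar hx hx2 h₁ h₂ h₃ hx₁ hx₂ hx₃
      hb₁ hb₂ hb₃ hc₁ hc₂ hc₃ e₁
  by_cases e₂ : IsExceptional X x M₂
  · exact orderOf_eq_three_of_isExceptional hfix hpar hx hx2 h₂ h₁ h₃ hx₂ hx₁ hx₃
      ha₂ ha₁ ha₃ hc₂ hc₁ hc₃ e₂
  by_cases e₃ : IsExceptional X x M₃
  · exact orderOf_eq_three_of_isExceptional hfix hpar hx hx2 h₃ h₁ h₂ hx₃ hx₁ hx₂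
      ha₃ ha₁ ha₂ hb₃ hb₁ hb₂ e₃
  exfalso
  have hcard : 2 < Nat.card G := hx.trans (Nat.le_of_dvd Nat.card_pos (orderOf_dvd_natCard x))
  have key : ∀ M : Subgroup G, IsCoatom M → x ∈ M → ¬ IsExceptional X x M →
      (∃ R ∈ fixedBy X x, M = stabilizer G R) ∨ M = stabilizer G (fixedBy X x) := by
    intro M hM hxM hE
    by_cases hf : ∃ R ∈ fixedBy X x, ∀ h ∈ M, h • R = R
    · obtain ⟨R, hR, hRf⟩ := hf
      exact .inl ⟨R, hR, hstab M hM R hRf⟩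
    by_cases hp : ∀ h ∈ M, ∀ R ∈ fixedBy X x, h • R ∈ fixedBy X x
    · right
      have hle : M ≤ stabilizer G (fixedBy X x) := by
        intro h hh
        rw [mem_stabilizer_set]
        exact fun R ↦ ⟨fun hR ↦ by simpa using hp h⁻¹ (inv_mem hh) _ hR, hp h hh R⟩
      refine ((hM.le_iff.1 hle).resolve_left fun ht ↦ ?_).symm
      obtain ⟨g, R, hR, hgR⟩ := exists_smul_notMem_of_ncard_eq_two hnofix hcard hx2
      exact hgR ((mem_stabilizer_set.1 (ht ▸ Subgroup.mem_top g : g ∈ stabilizer G _) R).2 hR)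
    · exact absurd (isExceptional_of_not_fixes_of_not_preserves hfix hpar hx hM.1 hxM hf hp) hE
  have fixes : ∀ P ∈ fixedBy X x, ∀ g ∈ stabilizer G (fixedBy X x), g • P = P →
      ∀ R ∈ fixedBy X x, g • R = R := by
    intro P hP g hg hgP R hR
    by_cases hPR : P = R
    · exact hPR ▸ hgP
    refine (eq_or_eq_of_ncard_eq_two hx2 hP hR hPR
      ((mem_stabilizer_set.1 hg R).2 hR)).resolve_left fun h ↦ hPR ?_
    exact smul_left_cancel g (hgP.trans h.symm)
  have hall : ∀ R ∈ fixedBy X x, a • R = R := by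
    rcases key M₂ h₂ hx₂ e₂ with ⟨P, hP, rfl⟩ | h2
    · rcases key M₃ h₃ hx₃ e₃ with ⟨Q, hQ, rfl⟩ | h3
      · intro R hR
        have hPQ : P ≠ Q := by rintro rfl; exact hb₂ hb₃
        rcases eq_or_eq_of_ncard_eq_two hx2 hP hQ hPQ hR with rfl | rfl
        · exact ha₂
        · exact ha₃
      · exact fixes P hP a (h3 ▸ ha₃) ha₂
    · rcases key M₃ h₃ hx₃ e₃ with ⟨Q, hQ, rfl⟩ | h3
      · exact fixes Q hQ a (h2 ▸ ha₂) ha₃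
      · exact absurd (h2 ▸ h3 ▸ hb₃) hb₂
  rcases key M₁ h₁ hx₁ e₁ with ⟨P, hP, rfl⟩ | h1
  · exact ha₁ (hall P hP)
  · apply ha₁
    rw [h1, mem_stabilizer_set]
    refine fun R ↦ ⟨fun hR ↦ ?_, fun hR ↦ (hall R hR).symm ▸ hR⟩
    have := hall _ hR
    rw [smul_left_cancel_iff] at this
    rwa [this] at hR

end

end

section

variable {G : Type*} [Group G]

theorem IsIrred.injective {n : ℕ} {g : Fin n → G} (hg : IsGenSeq g) (hirr : IsIrred g) :
    Function.Injective g := by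
  intro i j hij
  by_contra hne
  refine hirr i (top_le_iff.1 (hg ▸ Subgroup.closure_mono ?_))
  rintro _ ⟨k, rfl⟩
  by_cases hk : k = i
  · exact ⟨j, Ne.symm hne, by rw [hk, hij]⟩
  · exact ⟨k, hk, rfl⟩

theorem bddAbove_irredLen [Finite G] :
    BddAbove {n | ∃ g : Fin n → G, IsGenSeq g ∧ IsIrred g} := by
  refine ⟨Nat.card G, ?_⟩
  rintro n ⟨g, hg, hirr⟩
  simpa using Nat.card_le_card_of_injective g (hirr.injective hg)

/-- A finite set generating a group contains the entries of an irredundant generating sequence. -/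
theorem exists_irred_genSeq_of_closure_eq_top [Finite G] {S : Set G}
    (hS : Subgroup.closure S = ⊤) :
    ∃ (n : ℕ) (g : Fin n → G), (∀ i, g i ∈ S) ∧ IsGenSeq g ∧ IsIrred g := by
  obtain ⟨T, hT⟩ := (Set.toFinite {T : Set G | T ⊆ S ∧ Subgroup.closure T = ⊤}).exists_minimal
    ⟨S, subset_rfl, hS⟩
  obtain ⟨n, ⟨e⟩⟩ := Finite.exists_equiv_fin T
  refine ⟨n, fun i ↦ e.symm i, fun i ↦ hT.prop.1 (e.symm i).2, ?_, fun i hi ↦ ?_⟩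
  · rw [IsGenSeq, ← hT.prop.2]
    congr 1
    ext x
    exact ⟨by rintro ⟨i, rfl⟩; exact (e.symm i).2, fun hx ↦ ⟨e ⟨x, hx⟩, by simp⟩⟩
  · have hsub : (fun i ↦ (e.symm i : G)) '' {j | j ≠ i} ⊆ T := by
      rintro _ ⟨j, -, rfl⟩
      exact (e.symm j).2
    obtain ⟨j, hj, hji⟩ := hT.le_of_le ⟨hsub.trans hT.prop.1, hi⟩ hsub (e.symm i).2
    exact hj (e.symm.injective (Subtype.ext hji))

theorem closure_pair_ne_top_of_sq_eq_one [IsSimpleGroup G] (hnc : ∃ a b : G, a * b ≠ b * a)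
    {a b : G} (ha : a ^ 2 = 1) (hb : b ^ 2 = 1) : Subgroup.closure {a, b} ≠ ⊤ := by
  intro htop
  obtain ⟨c, d, hcd⟩ := hnc
  have cyc : ∀ u : G, Subgroup.zpowers u ≠ ⊤ := by
    intro u hu
    obtain ⟨k, rfl⟩ := (hu ▸ Subgroup.mem_top c : c ∈ Subgroup.zpowers u)
    obtain ⟨l, rfl⟩ := (hu ▸ Subgroup.mem_top d : d ∈ Subgroup.zpowers u)
    exact hcd ((Commute.refl u).zpow_zpow k l)
  have ha' : a⁻¹ = a := inv_eq_of_mul_eq_one_left (by rw [← sq, ha])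
  have hb' : b⁻¹ = b := inv_eq_of_mul_eq_one_left (by rw [← sq, hb])
  have hnorm : ∀ t : G, t⁻¹ = t → t * (a * b) * t⁻¹ = (a * b)⁻¹ →
      t ∈ Subgroup.normalizer (Subgroup.zpowers (a * b) : Set G) := by
    intro t ht htu
    have hmem : ∀ h ∈ Subgroup.zpowers (a * b), t * h * t⁻¹ ∈ Subgroup.zpowers (a * b) := by
      rintro _ ⟨k, rfl⟩
      dsimp only
      rw [← conj_zpow, htu]
      exact zpow_mem (inv_mem (Subgroup.mem_zpowers _)) k
    refine Subgroup.mem_normalizer_iff.2 fun h ↦ ⟨hmem h, fun hh ↦ ?_⟩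
    have := hmem _ hh
    rw [ht] at this
    have hsq : t * t = 1 := by nth_rw 1 [← ht]; exact inv_mul_cancel t
    rwa [show t * (t * h * t) * t = (t * t) * h * (t * t) by group, hsq, one_mul, mul_one] at this
  have hle : Subgroup.closure {a, b} ≤ Subgroup.normalizer (Subgroup.zpowers (a * b) : Set G) := by
    rw [Subgroup.closure_le]
    rintro t (rfl | rfl)
    · exact hnorm _ ha' (by rw [mul_inv_rev, ha', hb', ← mul_assoc, ← sq, ha, one_mul])
    · exact hnorm _ hb' (by rw [mul_inv_rev, ha', hb', mul_assoc, mul_assoc, ← sq, hb, mul_one])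
  rw [htop, top_le_iff, Subgroup.normalizer_eq_top_iff] at hle
  rcases hle.eq_bot_or_eq_top with h | h
  · rw [Subgroup.zpowers_eq_bot, mul_eq_one_iff_eq_inv, hb'] at h
    rw [h, Set.pair_eq_singleton, ← Subgroup.zpowers_eq_closure] at htop
    exact cyc b htop
  · exact cyc _ h

theorem three_le_maxIrredLen [Finite G] [IsSimpleGroup G] (hnc : ∃ a b : G, a * b ≠ b * a)
    (hinv : ∃ a : G, a ≠ 1 ∧ a ^ 2 = 1) : 3 ≤ maxIrredLen G := by
  obtain ⟨t, ht, ht2⟩ := hinv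
  have hS : Subgroup.closure (Group.conjugatesOfSet {t}) = ⊤ :=
    (Subgroup.normalClosure_normal (s := {t})).eq_bot_or_eq_top.resolve_left fun h ↦
      ht ((Subgroup.eq_bot_iff_forall _).1 h t (Subgroup.subset_normalClosure rfl))
  have hsq : ∀ a ∈ Group.conjugatesOfSet {t}, a ^ 2 = 1 := by
    intro a ha
    obtain ⟨_, rfl, hc⟩ := Group.mem_conjugatesOfSet_iff.1 ha
    obtain ⟨c, rfl⟩ := isConj_iff.1 hc
    rw [conj_pow, ht2, mul_one, mul_inv_cancel]
  obtain ⟨n, g, hgS, hg, hirr⟩ := exists_irred_genSeq_of_closure_eq_top hS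
  refine le_trans ?_ (le_csSup bddAbove_irredLen ⟨g, hg, hirr⟩)
  by_contra! hn
  obtain ⟨a, b, ha, hb, hab⟩ : ∃ a b : G, a ^ 2 = 1 ∧ b ^ 2 = 1 ∧ Set.range g ⊆ {a, b} := by
    interval_cases n
    · exact ⟨1, 1, by simp, by simp, by rintro _ ⟨i, rfl⟩; exact i.elim0⟩
    · exact ⟨g 0, g 0, hsq _ (hgS 0), hsq _ (hgS 0), by rintro _ ⟨i, rfl⟩; fin_cases i; simp⟩
    · exact ⟨g 0, g 1, hsq _ (hgS 0), hsq _ (hgS 1), by rintro _ ⟨i, rfl⟩; fin_cases i <;> simp⟩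
  exact closure_pair_ne_top_of_sq_eq_one hnc ha hb
    (top_le_iff.1 (hg ▸ Subgroup.closure_mono hab))

theorem IsWitnessToFailure.exists_coatoms [Finite G] {x : G} (hx : IsWitnessToFailure x) :
    ∃ (g : Fin (maxIrredLen G) → G) (M : Fin (maxIrredLen G) → Subgroup G),
      (∀ i, IsCoatom (M i)) ∧ (∀ i, x ∈ M i) ∧ (∀ i, g i ∉ M i) ∧ ∀ i j, i ≠ j → g i ∈ M j := by
  obtain ⟨-, g, hg, -, hrep⟩ := hx
  choose M hM hle using fun i ↦ (eq_top_or_exists_le_coatom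
    (Subgroup.closure (Set.range (Function.update g i x)))).resolve_left (hrep i)
  have hxM : ∀ i, x ∈ M i := fun i ↦
    hle i (Subgroup.subset_closure ⟨i, Function.update_self i x g⟩)
  have hgM : ∀ i j, i ≠ j → g i ∈ M j := fun i j hij ↦
    hle j (Subgroup.subset_closure ⟨i, Function.update_of_ne hij x g⟩)
  refine ⟨g, M, hM, hxM, fun i hi ↦ (hM i).1 ?_, hgM⟩
  rw [← top_le_iff, ← (show Subgroup.closure (Set.range g) = ⊤ from hg), Subgroup.closure_le]
  rintro _ ⟨j, rfl⟩
  by_cases hij : j = i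
  · exact hij ▸ hi
  · exact hgM j i hij

end

section

open Matrix MulAction OnePoint
open scoped MatrixGroups

theorem mem_center_SL2_iff {F : Type*} [Field F] {A : SL(2, F)} :
    A ∈ Subgroup.center SL(2, F) ↔ A 0 1 = 0 ∧ A 1 0 = 0 ∧ A 0 0 = A 1 1 := by
  rw [Matrix.SpecialLinearGroup.mem_center_iff]
  constructor
  · rintro ⟨r, -, hr⟩
    simp [← hr]
  · rintro ⟨h01, h10, hd⟩
    have hdet := A.det_coe
    rw [det_fin_two, h01, h10] at hdet
    refine ⟨A 0 0, by rw [Fintype.card_fin]; grind, ?_⟩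
    ext i j
    fin_cases i <;> fin_cases j <;> simp [h01, h10, hd]

/-- The action of `PSL(2, F)` by Möbius transformations over an extension `K` of `F`. -/
noncomputable def pslToPerm (F K : Type*) [Field F] [Field K] [DecidableEq K] [Algebra F K] :
    Matrix.ProjectiveSpecialLinearGroup (Fin 2) F →* Equiv.Perm (OnePoint K) :=
  QuotientGroup.lift _ ((toPermHom (GL (Fin 2) K) (OnePoint K)).comp
    (SpecialLinearGroup.mapGL K)) (by
      intro A hA
      obtain ⟨h01, h10, hd⟩ := mem_center_SL2_iff.1 hA
      have hdet := A.det_coe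
      rw [det_fin_two, h01, h10, ← hd] at hdet
      have hne : A 0 0 ≠ 0 := fun h ↦ by simp [h] at hdet
      ext R
      cases R with
      | infty => simp [smul_infty_eq_ite, h10]
      | coe z => simp [smul_some_eq_ite, h10, h01, ← hd, hne])

theorem ncard_fixedBy_eq_two_or_isParabolic {K : Type*} [Field K] [DecidableEq K] [IsAlgClosed K]
    [NeZero (2 : K)] {g : GL (Fin 2) K} (hg : ¬ (g 0 1 = 0 ∧ g 1 0 = 0 ∧ g 0 0 = g 1 1)) :
    (fixedBy (OnePoint K) g).ncard = 2 ∨ g.IsParabolic := by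
  have h2 : (2 : K) ≠ 0 := NeZero.ne 2
  have hpol : ∀ z : K, g • (z : OnePoint K) = z ↔
      g 1 0 * z ^ 2 + (g 1 1 - g 0 0) * z - g 0 1 = 0 := by
    intro z
    rw [← GeneralLinearGroup.fixpointPolynomial_aeval_eq_zero_iff]
    simp [GeneralLinearGroup.fixpointPolynomial]
  rw [or_iff_not_imp_right]
  intro hpar
  have hdisc : (g 1 1 - g 0 0) ^ 2 + 4 * g 1 0 * g 0 1 ≠ 0 := by
    intro h
    refine hpar ⟨?_, ?_⟩
    · rintro ⟨r, hr⟩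
      rw [← hr] at hg
      simp at hg
    · rw [discr_fin_two, trace_fin_two, det_fin_two, ← h]
      ring
  rw [Set.ncard_eq_two]
  by_cases hc : g 1 0 = 0
  · have hne : g 1 1 - g 0 0 ≠ 0 := fun h ↦ by simp [h, hc] at hdisc
    refine ⟨∞, ((g 0 1 / (g 1 1 - g 0 0) : K) : OnePoint K), infty_ne_coe _, ?_⟩
    ext R
    cases R with
    | infty => simp [smul_infty_eq_ite, hc]
    | coe z =>
      simp only [mem_fixedBy, hpol, Set.mem_insert_iff, coe_ne_infty, Set.mem_singleton_iff,
        coe_eq_coe, false_or, hc, eq_div_iff hne]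
      grind
  · obtain ⟨s, hs⟩ := IsAlgClosed.exists_pow_nat_eq ((g 1 1 - g 0 0) ^ 2 + 4 * g 1 0 * g 0 1)
      (n := 2) (by norm_num)
    have hs0 : s ≠ 0 := by rintro rfl; exact hdisc (by rw [← hs]; ring)
    have h2c : 2 * g 1 0 ≠ 0 := mul_ne_zero h2 hc
    refine ⟨(((g 0 0 - g 1 1 + s) / (2 * g 1 0) : K) : OnePoint K),
      (((g 0 0 - g 1 1 - s) / (2 * g 1 0) : K) : OnePoint K), ?_, ?_⟩
    · rw [Ne, coe_eq_coe, div_left_inj' h2c]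
      intro h
      exact mul_ne_zero h2 hs0 (by linear_combination h)
    · ext R
      cases R with
      | infty => simp [smul_infty_eq_ite, hc]
      | coe z =>
        simp only [mem_fixedBy, hpol, Set.mem_insert_iff, Set.mem_singleton_iff, coe_eq_coe,
          eq_div_iff h2c]
        have hfac : 4 * g 1 0 * (g 1 0 * z ^ 2 + (g 1 1 - g 0 0) * z - g 0 1) =
            (z * (2 * g 1 0) - (g 0 0 - g 1 1 + s)) *
              (z * (2 * g 1 0) - (g 0 0 - g 1 1 - s)) := by
          linear_combination hs
        have h4c : 4 * g 1 0 ≠ 0 := by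
          rw [show 4 * g 1 0 = 2 * (2 * g 1 0) by ring]
          exact mul_ne_zero h2 h2c
        rw [← sub_eq_zero (b := g 0 0 - g 1 1 + s), ← sub_eq_zero (b := g 0 0 - g 1 1 - s),
          ← mul_eq_zero, ← hfac, mul_eq_zero]
        simp [h4c]

theorem transvection_mem_of_transvection_mem {p : ℕ} [Fact p.Prime] {i j : Fin 2} (hij : i ≠ j)
    {H : Subgroup SL(2, ZMod p)} {t : ZMod p} (ht : t ≠ 0)
    (h : SpecialLinearGroup.transvection hij t ∈ H) (s : ZMod p) :
    SpecialLinearGroup.transvection hij s ∈ H := by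
  have key : ∀ n : ℕ, SpecialLinearGroup.transvection hij (n * t) ∈ H := by
    intro n
    induction n with
    | zero => simp
    | succ n ih =>
      rw [Nat.cast_succ, add_mul, one_mul, SpecialLinearGroup.transvection_add]
      exact mul_mem ih h
  have := key (s / t).val
  rwa [ZMod.natCast_zmod_val, div_mul_cancel₀ _ ht] at this

theorem lower_left_eq_zero_of_parabolic_mem {p : ℕ} [Fact p.Prime] (hp : p ≠ 2)
    {H : Subgroup SL(2, ZMod p)} (hH : H ≠ ⊤) {u : SL(2, ZMod p)} (hu : u ∈ H)
    (h10 : u 1 0 = 0) (hdiag : u 0 0 = u 1 1) (h01 : u 0 1 ≠ 0) {h : SL(2, ZMod p)} (hh : h ∈ H) :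
    h 1 0 = 0 := by
  have h2 : (2 : ZMod p) ≠ 0 := Ring.two_ne_zero (by simpa [ZMod.ringChar_zmod_n] using hp)
  by_contra hc
  have hdet := u.det_coe
  rw [det_fin_two, h10, ← hdiag] at hdet
  have hu00 : u 0 0 ≠ 0 := fun h ↦ by simp [h] at hdet
  have hsq : u ^ 2 = SpecialLinearGroup.transvection (zero_ne_one (α := Fin 2))
      (2 * u 0 0 * u 0 1) := by
    ext i j
    fin_cases i <;> fin_cases j
    all_goals simp [sq, mul_apply, Fin.sum_univ_two, SpecialLinearGroup.transvection_coe, h10,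
      ← hdiag]
    all_goals grind
  have upper := transvection_mem_of_transvection_mem zero_ne_one
    (mul_ne_zero (mul_ne_zero h2 hu00) h01) (hsq ▸ pow_mem hu 2)
  have hdet' := h.det_coe
  rw [det_fin_two] at hdet'
  have hw : ∃ w ∈ H, w 0 0 = 0 ∧ w 1 1 = 0 ∧ w 1 0 ≠ 0 := by
    refine ⟨_, mul_mem (mul_mem (upper (-(h 0 0 / h 1 0))) hh) (upper (-(h 1 1 / h 1 0))), ?_⟩
    simp [mul_apply, Fin.sum_univ_two, SpecialLinearGroup.transvection_coe]
    grind
  obtain ⟨w, hwH, hw00, hw11, hw10⟩ := hw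
  have hdetw := w.det_coe
  rw [det_fin_two, hw00] at hdetw
  have hlow : w * SpecialLinearGroup.transvection zero_ne_one 1 * w⁻¹ =
      SpecialLinearGroup.transvection (one_ne_zero (α := Fin 2)) (-(w 1 0) ^ 2) := by
    rw [mul_inv_eq_iff_eq_mul]
    ext i j
    fin_cases i <;> fin_cases j
    all_goals simp [mul_apply, Fin.sum_univ_two, SpecialLinearGroup.transvection_coe, hw00, hw11]
    all_goals grind
  have lower := transvection_mem_of_transvection_mem one_ne_zero
    (neg_ne_zero.2 (pow_ne_zero 2 hw10)) (hlow ▸ mul_mem (mul_mem hwH (upper 1)) (inv_mem hwH))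
  refine hH (top_le_iff.1 fun A _ ↦ SL2.transvection_induction (· ∈ H) (fun i j hij c ↦ ?_)
    (fun _ _ ↦ mul_mem) A)
  fin_cases i <;> fin_cases j
  · exact absurd rfl hij
  · exact upper c
  · exact lower c
  · exact absurd rfl hij

theorem exists_conj_lower_left_eq_zero {F : Type*} [Field F] [NeZero (2 : F)] {u : SL(2, F)}
    (hu : (u : Matrix (Fin 2) (Fin 2) F).trace ^ 2 = 4) :
    ∃ B : SL(2, F), (B⁻¹ * u * B) 1 0 = 0 := by
  have h2 : (2 : F) ≠ 0 := NeZero.ne 2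
  have hdet := u.det_coe
  rw [det_fin_two] at hdet
  rw [trace_fin_two] at hu
  by_cases hc : u 1 0 = 0
  · exact ⟨1, by simpa using hc⟩
  · let B : SL(2, F) := ⟨!![(u 0 0 - u 1 1) / (2 * u 1 0), -1; 1, 0], by simp [det_fin_two]⟩
    refine ⟨B, ?_⟩
    rw [Matrix.SpecialLinearGroup.coe_mul, Matrix.SpecialLinearGroup.coe_mul,
      Matrix.SpecialLinearGroup.coe_inv]
    simp only [mul_apply, Fin.sum_univ_two, adjugate_fin_two]
    simp [B]
    field_simp
    grind

theorem exists_smul_eq_of_trace_sq_eq_four {p : ℕ} [Fact p.Prime] (hp : p ≠ 2) (K : Type*) [Field K]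
    [DecidableEq K] [Algebra (ZMod p) K] {H : Subgroup SL(2, ZMod p)} (hH : H ≠ ⊤)
    {u : SL(2, ZMod p)} (hu : u ∈ H) (hcenter : u ∉ Subgroup.center SL(2, ZMod p))
    (htrace : (u : Matrix (Fin 2) (Fin 2) (ZMod p)).trace ^ 2 = 4) :
    ∃ R : OnePoint K, ∀ h ∈ H, SpecialLinearGroup.mapGL K h • R = R := by
  have : NeZero (2 : ZMod p) := ⟨Ring.two_ne_zero (by simpa [ZMod.ringChar_zmod_n] using hp)⟩
  obtain ⟨B, hB⟩ := exists_conj_lower_left_eq_zero htrace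
  have hconj : ∀ h : SL(2, ZMod p), MulAut.conj B (B⁻¹ * h * B) = h := by
    intro h
    simp [mul_assoc]
  have htrace' : ((B⁻¹ * u * B : SL(2, ZMod p)) : Matrix (Fin 2) (Fin 2) (ZMod p)).trace ^ 2 =
      4 := by
    rw [← htrace, Matrix.SpecialLinearGroup.coe_mul, trace_mul_comm,
      ← Matrix.SpecialLinearGroup.coe_mul]
    simp
  have hdet := (B⁻¹ * u * B).det_coe
  rw [det_fin_two, hB] at hdet
  rw [trace_fin_two] at htrace'
  have hdiag : (B⁻¹ * u * B) 0 0 = (B⁻¹ * u * B) 1 1 := by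
    rw [← sub_eq_zero, ← sq_eq_zero_iff]
    linear_combination htrace' - 4 * hdet
  have h01 : (B⁻¹ * u * B) 0 1 ≠ 0 := by
    intro h01
    have hmem : B⁻¹ * u * B ∈ Subgroup.center SL(2, ZMod p) := mem_center_SL2_iff.2 ⟨h01, hB, hdiag⟩
    refine hcenter ?_
    rw [← hconj u]
    exact Subgroup.Normal.conj_mem inferInstance _ hmem B
  refine ⟨SpecialLinearGroup.mapGL K B • ∞, fun h hh ↦ ?_⟩
  have hzero := lower_left_eq_zero_of_parabolic_mem hp (H := H.comap (MulAut.conj B).toMonoidHom)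
    (u := B⁻¹ * u * B) (h := B⁻¹ * h * B) ?_ ?_ hB hdiag h01 ?_
  · rw [← inv_smul_eq_iff, smul_smul, smul_smul, ← map_inv, ← map_mul, ← map_mul,
      smul_infty_eq_self_iff, SpecialLinearGroup.mapGL_coe_matrix]
    simp only [SpecialLinearGroup.map_apply_coe, RingHom.mapMatrix_apply, map_apply, hzero,
      map_zero]
  · refine fun htop ↦ hH (top_le_iff.1 fun A _ ↦ ?_)
    have hA : B⁻¹ * A * B ∈ H.comap (MulAut.conj B).toMonoidHom := htop ▸ Subgroup.mem_top _
    rw [Subgroup.mem_comap, MulEquiv.coe_toMonoidHom, hconj] at hA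
    exact hA
  · rwa [Subgroup.mem_comap, MulEquiv.coe_toMonoidHom, hconj]
  · rwa [Subgroup.mem_comap, MulEquiv.coe_toMonoidHom, hconj]

theorem ncard_fixedBy_mapGL {F K : Type*} [Field F] [Field K] [DecidableEq K] [Algebra F K]
    [IsAlgClosed K] [NeZero (2 : K)] {A : SL(2, F)} (hA : A ∉ Subgroup.center SL(2, F)) :
    (fixedBy (OnePoint K) (SpecialLinearGroup.mapGL K A)).ncard = 2 ∨
      (fixedBy (OnePoint K) (SpecialLinearGroup.mapGL K A)).ncard = 1 ∧
        (A : Matrix (Fin 2) (Fin 2) F).trace ^ 2 = 4 := by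
  have hinj := (algebraMap F K).injective
  refine (ncard_fixedBy_eq_two_or_isParabolic fun h ↦ hA (mem_center_SL2_iff.2 ?_)).imp id
    fun hpar ↦ ⟨Set.ncard_eq_one.2 ⟨_, Set.ext fun c ↦ hpar.smul_eq_self_iff⟩, ?_⟩
  · simpa [SpecialLinearGroup.mapGL_coe_matrix, hinj.eq_iff] using h
  · have h := hpar.2
    have hdet := A.det_coe
    rw [det_fin_two] at hdet
    rw [discr_fin_two, trace_fin_two, det_fin_two, SpecialLinearGroup.mapGL_coe_matrix] at h
    apply hinj
    simp only [trace_fin_two, SpecialLinearGroup.map_apply_coe, RingHom.mapMatrix_apply, map_apply,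
      ← map_mul, ← map_sub, ← map_add, hdet] at h ⊢
    simp only [map_one, map_pow, map_ofNat] at h ⊢
    linear_combination h

theorem not_mem_center_of_mk_ne_one {F : Type*} [Field F] {A : SL(2, F)}
    (hA : (QuotientGroup.mk A : ProjectiveSpecialLinearGroup (Fin 2) F) ≠ 1) :
    A ∉ Subgroup.center SL(2, F) :=
  fun h ↦ hA ((QuotientGroup.eq_one_iff A).2 h)

theorem pslToPerm_mk {F K : Type*} [Field F] [Field K] [DecidableEq K] [Algebra F K] (A : SL(2, F))
    (R : OnePoint K) : pslToPerm F K (QuotientGroup.mk A) R = SpecialLinearGroup.mapGL K A • R :=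
  rfl

theorem mod_ten_of_five_dvd_card_psl {p : ℕ} [Fact p.Prime] (hp : 5 < p)
    (h : 5 ∣ Nat.card (PSL p)) :
    p % 10 = 1 ∨ p % 10 = 9 := by
  have hpp : p.Prime := Fact.out
  have hGL : 5 ∣ Nat.card (GL (Fin 2) (ZMod p)) :=
    (h.trans (Subgroup.card_quotient_dvd_card _)).trans
      (Subgroup.card_dvd_of_injective SpecialLinearGroup.toGL SpecialLinearGroup.toGL_injective)
  rw [card_GL_field, Fin.prod_univ_two, ZMod.card] at hGL
  have h5 : ¬ 5 ∣ p := fun h ↦ by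
    have := (Nat.prime_dvd_prime_iff_eq Nat.prime_five hpp).1 h
    omega
  have h2 : ¬ 2 ∣ p := fun h ↦ by
    have := (Nat.prime_dvd_prime_iff_eq Nat.prime_two hpp).1 h
    omega
  obtain ⟨k, rfl⟩ : ∃ k, p = k + 1 := ⟨p - 1, by omega⟩
  have e0 : (k + 1) ^ 2 - (k + 1) ^ ((0 : Fin 2) : ℕ) = k * (k + 2) := by
    rw [Fin.val_zero, Nat.sub_eq_iff_eq_add (Nat.pow_le_pow_right (by omega) (by omega))]
    ring
  have e1 : (k + 1) ^ 2 - (k + 1) ^ ((1 : Fin 2) : ℕ) = k * (k + 1) := by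
    rw [Fin.val_one, Nat.sub_eq_iff_eq_add (Nat.pow_le_pow_right (by omega) (by omega))]
    ring
  rw [e0, e1, Nat.prime_five.dvd_mul, Nat.prime_five.dvd_mul, Nat.prime_five.dvd_mul] at hGL
  omega

theorem exists_psl_involution {p : ℕ} [Fact p.Prime] : ∃ a : PSL p, a ≠ 1 ∧ a ^ 2 = 1 := by
  let w : SL(2, ZMod p) := ⟨!![0, -1; 1, 0], by simp [det_fin_two]⟩
  refine ⟨QuotientGroup.mk w, ?_, ?_⟩
  · rw [Ne, QuotientGroup.eq_one_iff, mem_center_SL2_iff]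
    simp [w]
  · rw [sq, ← QuotientGroup.mk_mul, QuotientGroup.eq_one_iff, mem_center_SL2_iff,
      Matrix.SpecialLinearGroup.coe_mul]
    simp [w]

theorem exists_psl_not_commute {p : ℕ} [Fact p.Prime] : ∃ a b : PSL p, a * b ≠ b * a := by
  refine ⟨QuotientGroup.mk (SpecialLinearGroup.transvection zero_ne_one 1),
    QuotientGroup.mk (SpecialLinearGroup.transvection one_ne_zero 1), fun h ↦ ?_⟩
  have h' := DFunLike.congr_fun (congrArg (pslToPerm (ZMod p) (ZMod p)) h) ∞
  simp only [map_mul, Equiv.Perm.mul_apply, pslToPerm_mk] at h'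
  simp [smul_infty_eq_ite, smul_some_eq_ite, SpecialLinearGroup.transvection_coe] at h'

theorem orderOf_eq_three_of_isWitnessToFailure {p : ℕ} [Fact p.Prime] (hp : 5 < p) {x : PSL p}
    (hx : IsWitnessToFailure x) (h3 : 3 ≤ orderOf x) :
    orderOf x = 3 ∧ ∃ H : Subgroup (PSL p), Nat.card H = 60 := by
  classical
  let K := AlgebraicClosure (ZMod p)
  have : NeZero (2 : ZMod p) :=
    ⟨Ring.two_ne_zero (by rw [ZMod.ringChar_zmod_n]; omega)⟩
  have h2 : NeZero (2 : K) :=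
    ⟨by simpa only [map_ofNat, map_zero] using
      (algebraMap (ZMod p) K).injective.ne (NeZero.ne (2 : ZMod p))⟩
  let _ : MulAction (PSL p) (OnePoint K) := MulAction.compHom _ (pslToPerm (ZMod p) K)
  have hsmul : ∀ (A : SL(2, ZMod p)) (R : OnePoint K),
      (QuotientGroup.mk A : PSL p) • R = SpecialLinearGroup.mapGL K A • R := fun _ _ ↦ rfl
  have hfixedBy : ∀ A : SL(2, ZMod p), fixedBy (OnePoint K) (QuotientGroup.mk A : PSL p) =
      fixedBy (OnePoint K) (SpecialLinearGroup.mapGL K A) := fun _ ↦ rfl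
  have : IsSimpleGroup (PSL p) :=
    ProjectiveSpecialLinearGroup.rank_two_simple (by rw [Nat.card_zmod]; omega)
  obtain ⟨g, M, hM, hxM, hgM, hgM'⟩ := hx.exists_coatoms
  have hlen := three_le_maxIrredLen (exists_psl_not_commute (p := p)) exists_psl_involution
  let i₁ : Fin (maxIrredLen (PSL p)) := ⟨0, by omega⟩
  let i₂ : Fin (maxIrredLen (PSL p)) := ⟨1, by omega⟩
  let i₃ : Fin (maxIrredLen (PSL p)) := ⟨2, by omega⟩
  have h₁₂ : i₁ ≠ i₂ := by simp [i₁, i₂]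
  have h₁₃ : i₁ ≠ i₃ := by simp [i₁, i₃]
  have h₂₃ : i₂ ≠ i₃ := by simp [i₂, i₃]
  refine orderOf_eq_three_of_coatoms (X := OnePoint K) ?_ ?_ ?_ h3 (hM i₁) (hM i₂) (hM i₃)
    (hxM i₁) (hxM i₂) (hxM i₃) (hgM i₁) (hgM' i₁ i₂ h₁₂) (hgM' i₁ i₃ h₁₃) (hgM' i₂ i₁ h₁₂.symm)
    (hgM i₂) (hgM' i₂ i₃ h₂₃) (hgM' i₃ i₁ h₁₃.symm) (hgM' i₃ i₂ h₂₃.symm) (hgM i₃)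
  · intro a ha
    induction a using QuotientGroup.induction_on with
    | H A =>
      rw [hfixedBy]
      exact (ncard_fixedBy_mapGL (not_mem_center_of_mk_ne_one ha)).symm.imp And.left id
  · intro H hH u hu hcard
    induction u using QuotientGroup.induction_on with
    | H A =>
      have hA : A ∉ Subgroup.center SL(2, ZMod p) := by
        intro hA
        have h1 : (QuotientGroup.mk A : PSL p) = 1 := (QuotientGroup.eq_one_iff A).2 hA
        have huniv : fixedBy (OnePoint K) (QuotientGroup.mk A : PSL p) = Set.univ := by
          ext R
          simp [h1]
        obtain ⟨R, hR⟩ := Set.ncard_eq_one.1 (huniv ▸ hcard)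
        have h0 : ((0 : K) : OnePoint K) ∈ ({R} : Set (OnePoint K)) := hR ▸ Set.mem_univ _
        have h1 : (∞ : OnePoint K) ∈ ({R} : Set (OnePoint K)) := hR ▸ Set.mem_univ _
        exact infty_ne_coe _ (h1.trans h0.symm)
      rw [hfixedBy] at hcard
      obtain h | ⟨-, htrace⟩ := ncard_fixedBy_mapGL (K := K) hA
      · omega
      obtain ⟨R, hR⟩ := exists_smul_eq_of_trace_sq_eq_four (by omega) K
        (H := H.comap (QuotientGroup.mk' _))
        (fun h ↦ hH (Subgroup.comap_injective (QuotientGroup.mk'_surjective _)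
          (h.trans (Subgroup.comap_top _).symm))) hu hA htrace
      refine ⟨R, fun h hh ↦ ?_⟩
      induction h using QuotientGroup.induction_on with
      | H B => exact hR B hh
  · intro R
    cases R with
    | infty =>
      refine ⟨QuotientGroup.mk (SpecialLinearGroup.transvection one_ne_zero 1), ?_⟩
      rw [hsmul, Ne, smul_infty_eq_self_iff]
      simp [SpecialLinearGroup.transvection_coe]
    | coe z =>
      refine ⟨QuotientGroup.mk (SpecialLinearGroup.transvection zero_ne_one 1), ?_⟩
      rw [hsmul, smul_some_eq_ite]
      simp [SpecialLinearGroup.transvection_coe]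

end

theorem psl_witness_order_two_or_three (p : ℕ) [Fact p.Prime] (hp : 5 < p)
    (g : PSL p) (hg : IsWitnessToFailure g) :
    (orderOf g = 2 ∨ orderOf g = 3) ∧
      (p % 10 ∉ ({1, 9} : Set ℕ) → orderOf g = 2) := by
  have hpos := orderOf_pos g
  have hne : orderOf g ≠ 1 := fun h ↦ hg.1 (orderOf_eq_one_iff.1 h)
  by_cases h3 : 3 ≤ orderOf g
  · obtain ⟨horder, H, hH⟩ := orderOf_eq_three_of_isWitnessToFailure hp hg h3
    refine ⟨Or.inr horder, fun hmod ↦ absurd (mod_ten_of_five_dvd_card_psl hp ?_) hmod⟩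
    exact (show 5 ∣ Nat.card H by rw [hH]; norm_num).trans (Subgroup.card_subgroup_dvd_card H)
  · have h2 : orderOf g = 2 := by omega
    exact ⟨Or.inl h2, fun _ ↦ h2⟩
end

section
/- Let p be a prime with p > 5. Then no element of order p in PSL(2,p) is a witness to failure; that is, every witness to failure for PSL(2,p) has order different from p. -/
open Matrix

/-- The upper unitriangular matrix with upper right entry `t`. -/
def upperUnip {F : Type*} [CommRing F] (t : F) : Matrix.SpecialLinearGroup (Fin 2) F :=
  ⟨!![1, t; 0, 1], by simp⟩

/-- The lower unitriangular matrix with lower left entry `t`. -/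
def lowerUnip {F : Type*} [CommRing F] (t : F) : Matrix.SpecialLinearGroup (Fin 2) F :=
  ⟨!![1, 0; t, 1], by simp⟩

@[simp]
theorem coe_upperUnip {F : Type*} [CommRing F] (t : F) :
    (upperUnip t : Matrix (Fin 2) (Fin 2) F) = !![1, t; 0, 1] := rfl

@[simp]
theorem coe_lowerUnip {F : Type*} [CommRing F] (t : F) :
    (lowerUnip t : Matrix (Fin 2) (Fin 2) F) = !![1, 0; t, 1] := rfl

/-- The matrices in `SL(2, F)` that are upper triangular. -/
def upperTriangular (F : Type*) [CommRing F] : Subgroup (Matrix.SpecialLinearGroup (Fin 2) F) where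
  carrier := {A | A 1 0 = 0}
  one_mem' := by simp
  mul_mem' {A B} hA hB := by
    simp only [Set.mem_ofPred_eq] at hA hB ⊢
    simp [Matrix.mul_apply, Fin.sum_univ_two, hA, hB]
  inv_mem' {A} hA := by
    simp only [Set.mem_ofPred_eq] at hA ⊢
    simp [Matrix.adjugate_fin_two, hA]

theorem mem_upperTriangular {F : Type*} [CommRing F] {A : Matrix.SpecialLinearGroup (Fin 2) F} :
    A ∈ upperTriangular F ↔ A 1 0 = 0 := Iff.rfl

theorem eq_upperUnip_mul_lowerUnip_mul_upperUnip {F : Type*} [Field F] (A : Matrix.SpecialLinearGroup (Fin 2) F)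
    (hA : A 1 0 ≠ 0) :
    A = upperUnip ((A 0 0 - 1) / A 1 0) * lowerUnip (A 1 0) *
      upperUnip ((A 1 1 - 1) / A 1 0) := by
  have hdet := A.det_coe
  rw [Matrix.det_fin_two] at hdet
  ext i j
  fin_cases i <;> fin_cases j <;>
    simp [Matrix.mul_apply, Fin.sum_univ_two] <;> field_simp <;>
    first
    | ring1
    | linear_combination -hdet

theorem mem_of_upperUnip_mem_of_lowerUnip_mem {F : Type*} [Field F]
    {K : Subgroup (Matrix.SpecialLinearGroup (Fin 2) F)} (hU : ∀ t, upperUnip t ∈ K)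
    (hL : ∀ t, lowerUnip t ∈ K) (A : Matrix.SpecialLinearGroup (Fin 2) F) : A ∈ K := by
  have key : ∀ B : Matrix.SpecialLinearGroup (Fin 2) F, B 1 0 ≠ 0 → B ∈ K := fun B hB => by
    rw [eq_upperUnip_mul_lowerUnip_mul_upperUnip B hB]
    exact mul_mem (mul_mem (hU _) (hL _)) (hU _)
  by_cases hA : A 1 0 = 0
  · have hdet := A.det_coe
    rw [Matrix.det_fin_two, hA] at hdet
    refine (K.mul_mem_cancel_left (hL 1)).1 (key _ ?_)
    have h0 : A 0 0 ≠ 0 := fun h => by simp [h] at hdet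
    simpa [Matrix.mul_apply, Fin.sum_univ_two, hA] using h0
  · exact key A hA

/-- A proper subgroup of `SL(2, F)` containing the upper unitriangular matrices consists of upper
triangular matrices. -/
theorem le_upperTriangular_of_upperUnip_mem {F : Type*} [Field F]
    {K : Subgroup (Matrix.SpecialLinearGroup (Fin 2) F)} (hK : K ≠ ⊤) (hU : ∀ t, upperUnip t ∈ K) :
    K ≤ upperTriangular F := by
  intro A hAK
  by_contra hA
  replace hA : A 1 0 ≠ 0 := hA
  refine hK (eq_top_iff.2 fun B _ => mem_of_upperUnip_mem_of_lowerUnip_mem hU (fun t => ?_) B)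
  have hdet := A.det_coe
  rw [Matrix.det_fin_two] at hdet
  have hw : upperUnip (-A 0 0 / A 1 0) * A * upperUnip (-A 1 1 / A 1 0) ∈ K :=
    mul_mem (mul_mem (hU _) hAK) (hU _)
  set w := upperUnip (-A 0 0 / A 1 0) * A * upperUnip (-A 1 1 / A 1 0)
  have hwm : (w : Matrix (Fin 2) (Fin 2) F) = !![0, -(A 1 0)⁻¹; A 1 0, 0] := by
    ext i j
    fin_cases i <;> fin_cases j <;>
      simp [w, Matrix.mul_apply, Fin.sum_univ_two, Matrix.vecMul, dotProduct] <;> field_simp <;>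
      first
      | ring1
      | linear_combination -hdet
  have hc : lowerUnip t * w = w * upperUnip (-t / A 1 0 ^ 2) := by
    ext i j
    fin_cases i <;> fin_cases j <;> simp [hwm]
    field_simp
  exact (K.mul_mem_cancel_right hw).1 (hc ▸ mul_mem hw (hU _))

theorem upperUnip_pow {F : Type*} [CommRing F] (s : F) (n : ℕ) :
    upperUnip s ^ n = upperUnip (n * s) := by
  induction n with
  | zero => ext i j; fin_cases i <;> fin_cases j <;> simp
  | succ n ih =>
    rw [pow_succ, ih]
    ext i j
    fin_cases i <;> fin_cases j <;>
      simp [Matrix.mul_apply, Fin.sum_univ_two]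
    ring

theorem upperUnip_mem {p : ℕ} [Fact p.Prime]
    {K : Subgroup (Matrix.SpecialLinearGroup (Fin 2) (ZMod p))} {s : ZMod p} (hs : s ≠ 0)
    (h : upperUnip s ∈ K) (t : ZMod p) : upperUnip t ∈ K := by
  have := pow_mem h (t / s).val
  rwa [upperUnip_pow, ZMod.natCast_zmod_val, div_mul_cancel₀ _ hs] at this

theorem exists_specialLinearGroup_col {F : Type*} [Field F] {v : Fin 2 → F} (hv : v ≠ 0) :
    ∃ P : Matrix.SpecialLinearGroup (Fin 2) F, ∀ i, P i 0 = v i := by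
  by_cases h0 : v 0 = 0
  · have h1 : v 1 ≠ 0 := fun h1 => hv (by ext i; fin_cases i <;> simp [h0, h1])
    exact ⟨⟨!![v 0, -(v 1)⁻¹; v 1, 0], by simp [Matrix.det_fin_two, h1]⟩,
      fun i => by fin_cases i <;> simp⟩
  · exact ⟨⟨!![v 0, 0; v 1, (v 0)⁻¹], by simp [Matrix.det_fin_two, h0]⟩,
      fun i => by fin_cases i <;> simp⟩

theorem exists_conj_eq_upperUnip {F : Type*} [Field F] (A : Matrix.SpecialLinearGroup (Fin 2) F)
    (htr : (A : Matrix (Fin 2) (Fin 2) F).trace = 2) :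
    ∃ (P : Matrix.SpecialLinearGroup (Fin 2) F) (s : F), A = P * upperUnip s * P⁻¹ := by
  have hdet := A.det_coe
  rw [Matrix.det_fin_two] at hdet
  rw [Matrix.trace_fin_two] at htr
  obtain ⟨v, hv, hAv⟩ := (Matrix.exists_mulVec_eq_zero_iff
    (M := (A : Matrix (Fin 2) (Fin 2) F) - 1)).2 (by
      rw [Matrix.det_fin_two]
      simp
      linear_combination hdet - htr)
  obtain ⟨P, hP⟩ := exists_specialLinearGroup_col hv
  have hPdet := P.det_coe
  rw [Matrix.det_fin_two] at hPdet
  have e0 := congrFun hAv 0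
  have e1 := congrFun hAv 1
  simp [Matrix.mulVec, dotProduct, Fin.sum_univ_two, ← hP] at e0 e1
  refine ⟨P, (P⁻¹ * A * P) 0 1, ?_⟩
  rw [eq_mul_inv_iff_mul_eq, ← inv_mul_eq_iff_eq_mul, ← mul_assoc]
  ext i j
  fin_cases i <;> fin_cases j <;>
    simp [Matrix.mul_apply, Fin.sum_univ_two, Matrix.adjugate_fin_two,
      Matrix.vecMul, dotProduct]
  · linear_combination P 1 1 * e0 - P 0 1 * e1 + hPdet
  · linear_combination -P 1 0 * e0 + P 0 0 * e1
  · linear_combination (P 0 0 * P 1 1 - P 0 1 * P 1 0) * htr + hPdet - P 1 1 * e0 + P 0 1 * e1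

theorem not_commute_upperUnip_lowerUnip {p : ℕ} [Fact p.Prime] :
    ¬ Commute (QuotientGroup.mk (upperUnip 1) : PSL p) (QuotientGroup.mk (lowerUnip 1)) := by
  intro h
  obtain ⟨r, -, hr⟩ := Matrix.SpecialLinearGroup.mem_center_iff.1 (QuotientGroup.eq.1 h.eq)
  have hr' : ((upperUnip 1 * lowerUnip 1 : Matrix.SpecialLinearGroup (Fin 2) (ZMod p)) :
      Matrix (Fin 2) (Fin 2) (ZMod p)) * scalar (Fin 2) r = (lowerUnip 1 * upperUnip 1 :
        Matrix.SpecialLinearGroup (Fin 2) (ZMod p)) := by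
    rw [hr, ← Matrix.SpecialLinearGroup.coe_mul, mul_inv_cancel_left]
  have h01 := congrFun (congrFun hr' 0) 1
  have h00 := congrFun (congrFun hr' 0) 0
  simp [Matrix.mul_apply, Fin.sum_univ_two] at h01 h00
  rw [h01] at h00
  exact one_ne_zero (α := ZMod p) (by linear_combination h00)

theorem exists_conj_upperTriangular_of_orderOf_eq {p : ℕ} [Fact p.Prime] (hp : 2 < p)
    {x : PSL p} (hx : orderOf x = p) :
    ∃ P : Matrix.SpecialLinearGroup (Fin 2) (ZMod p), ∀ H : Subgroup (PSL p), H ≠ ⊤ → x ∈ H →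
      ∀ A : Matrix.SpecialLinearGroup (Fin 2) (ZMod p), (QuotientGroup.mk A : PSL p) ∈ H →
        P⁻¹ * A * P ∈ upperTriangular (ZMod p) := by
  obtain ⟨A, rfl⟩ := QuotientGroup.mk_surjective x
  have hA : A ^ p ∈ Subgroup.center (Matrix.SpecialLinearGroup (Fin 2) (ZMod p)) := by
    rw [← QuotientGroup.eq_one_iff, QuotientGroup.mk_pow]
    exact orderOf_dvd_iff_pow_eq_one.1 hx.dvd
  obtain ⟨r, hr, hrA⟩ := Matrix.SpecialLinearGroup.mem_center_iff.1 hA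
  have hA2 : (A ^ 2) ^ p = 1 := by
    rw [← pow_mul, mul_comm, pow_mul]
    ext1
    rw [Matrix.SpecialLinearGroup.coe_pow, ← hrA, ← map_pow,
      show r ^ 2 = 1 by simpa using hr, map_one,
      Matrix.SpecialLinearGroup.coe_one]
  have htr : ((A ^ 2 : Matrix.SpecialLinearGroup (Fin 2) (ZMod p)) :
      Matrix (Fin 2) (Fin 2) (ZMod p)).trace = 2 := by
    have := ZMod.trace_pow_card
      ((A ^ 2 : Matrix.SpecialLinearGroup (Fin 2) (ZMod p)) : Matrix (Fin 2) (Fin 2) (ZMod p))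
    rw [← Matrix.SpecialLinearGroup.coe_pow, hA2, ZMod.pow_card] at this
    rw [← this]
    simp
  obtain ⟨P, s, hP⟩ := exists_conj_eq_upperUnip _ htr
  have hs : s ≠ 0 := by
    rintro rfl
    have h1 : (upperUnip 0 : Matrix.SpecialLinearGroup (Fin 2) (ZMod p)) = 1 := by
      ext i j; fin_cases i <;> fin_cases j <;> simp
    rw [h1, mul_one, mul_inv_cancel] at hP
    have h2 : (QuotientGroup.mk A : PSL p) ^ 2 = 1 := by
      rw [← QuotientGroup.mk_pow, hP, QuotientGroup.mk_one]
    have := Nat.le_of_dvd two_pos (orderOf_dvd_of_pow_eq_one h2)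
    omega
  refine ⟨P, fun H hH hAH B hB => ?_⟩
  let f := (QuotientGroup.mk' (Subgroup.center (Matrix.SpecialLinearGroup (Fin 2) (ZMod p)))).comp
    (MulAut.conj P).toMonoidHom
  have hf : Function.Surjective f :=
    (QuotientGroup.mk'_surjective _).comp (MulAut.conj P).surjective
  refine le_upperTriangular_of_upperUnip_mem (K := H.comap f)
    (fun h => hH (Subgroup.comap_injective hf (h.trans (Subgroup.comap_top f).symm)))
    (upperUnip_mem hs ?_) ?_
  · change (QuotientGroup.mk (P * upperUnip s * P⁻¹) : PSL p) ∈ H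
    rw [← hP, QuotientGroup.mk_pow]
    exact pow_mem hAH 2
  · change (QuotientGroup.mk (P * (P⁻¹ * B * P) * P⁻¹) : PSL p) ∈ H
    simpa [mul_assoc] using hB

theorem commute_of_subsingleton_of_isGenSeq {G : Type*} [Group G] {n : ℕ} [Subsingleton (Fin n)]
    {g : Fin n → G} (hg : IsGenSeq g) (x y : G) : Commute x y := by
  have hx : x ∈ Subgroup.closure (Set.range g) := hg ▸ Subgroup.mem_top x
  have hy : y ∈ Subgroup.closure (Set.range g) := hg ▸ Subgroup.mem_top y
  refine Subgroup.closure_induction₂ (p := fun x y _ _ => Commute x y) ?_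
    (fun _ _ => Commute.one_left _) (fun _ _ => Commute.one_right _)
    (fun _ _ _ _ _ _ h₁ h₂ => h₁.mul_left h₂) (fun _ _ _ _ _ _ h₁ h₂ => h₁.mul_right h₂)
    (fun _ _ _ _ h => h.inv_left) (fun _ _ _ _ h => h.inv_right) hx hy
  rintro _ _ ⟨i, rfl⟩ ⟨j, rfl⟩
  rw [Subsingleton.elim i j]
  exact Commute.refl _

theorem psl_no_witness_of_order_p (p : ℕ) [Fact p.Prime] (hp : 5 < p)
    (g : PSL p) (hg : IsWitnessToFailure g) :
    orderOf g ≠ p := by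
  intro hord
  obtain ⟨-, a, hgen, -, hfail⟩ := hg
  obtain h | h := subsingleton_or_nontrivial (Fin (maxIrredLen (PSL p)))
  · exact not_commute_upperUnip_lowerUnip (commute_of_subsingleton_of_isGenSeq hgen _ _)
  obtain ⟨P, hP⟩ := exists_conj_upperTriangular_of_orderOf_eq (by omega) hord
  let B := (upperTriangular (ZMod p)).comap (MulAut.conj P⁻¹).toMonoidHom
  have hB {A : Matrix.SpecialLinearGroup (Fin 2) (ZMod p)} : A ∈ B ↔
      P⁻¹ * A * P ∈ upperTriangular (ZMod p) := by
    simp [B]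
  have hmem (i) : g ∈ Subgroup.closure (Set.range (Function.update a i g)) :=
    Subgroup.subset_closure ⟨i, by simp⟩
  let q := QuotientGroup.mk' (Subgroup.center (Matrix.SpecialLinearGroup (Fin 2) (ZMod p)))
  have hker : q.ker ≤ B := fun A hA => by
    obtain ⟨i, -⟩ := exists_pair_ne (Fin (maxIrredLen (PSL p)))
    refine hB.2 (hP _ (hfail i) (hmem i) A ?_)
    rw [show (QuotientGroup.mk A : PSL p) = 1 from hA]
    exact one_mem _
  have htop : B.map q = ⊤ := by
    rw [eq_top_iff, ← hgen, Subgroup.closure_le]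
    rintro _ ⟨j, rfl⟩
    obtain ⟨A, hA⟩ := QuotientGroup.mk_surjective (a j)
    obtain ⟨i, hij⟩ := exists_ne j
    refine ⟨A, hB.2 (hP _ (hfail i) (hmem i) A ?_), hA⟩
    rw [hA]
    exact Subgroup.subset_closure ⟨j, by simp [hij.symm]⟩
  have hBtop : B = ⊤ := by
    rw [← Subgroup.comap_map_eq_self hker, htop, Subgroup.comap_top]
  have hL : P * lowerUnip 1 * P⁻¹ ∈ B := hBtop ▸ Subgroup.mem_top _
  rw [hB, mem_upperTriangular] at hL
  simp only [mul_assoc, inv_mul_cancel_left, inv_mul_cancel, mul_one] at hL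
  simp at hL
end
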